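/- arXiv:1406.2999 — 2 statements merged into one kernel-verified Lean document; each statement's English description precedes it below -/
import Mathlib

section
/- Let p ≥ 5 be a prime. Then v(D^{p²}(A^p)) ≥ 3; that is, D^{p²}(A^p) lies in the cube (A^p, p)³ of the ideal (A^p, p) of ℤ_(p)[P,Q,R]. -/
open MvPolynomial Finset

noncomputable section

/-- `x` lies in `ℤ_(p) ⊆ ℚ`: `p` does not divide the reduced denominator of `x`. -/
def pInt (p : ℕ) (x : ℚ) : Prop := ¬ p ∣ x.den

/-- The polynomial ring `ℚ[P,Q,R]`, with `P = X 0`, `Q = X 1`, `R = X 2`. -/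
abbrev Poly3 : Type := MvPolynomial (Fin 3) ℚ

/-- `f` has all of its coefficients in `ℤ_(p)`. -/
def polyPInt (p : ℕ) (f : Poly3) : Prop := ∀ m : Fin 3 →₀ ℕ, pInt p (coeff m f)

/-- `f` is isobaric of weight `w`, where `P, Q, R` have weights `2, 4, 6`. -/
def Isobaric (w : ℕ) (f : Poly3) : Prop :=
  ∀ m ∈ f.support, 2 * m 0 + 4 * m 1 + 6 * m 2 = w

/-- `f` does not involve the variable `P`. -/
def NoP (f : Poly3) : Prop := ∀ m ∈ f.support, m 0 = 0

/-- The Ramanujan derivation `D` on `ℚ[P,Q,R]`, the unique derivation with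
`DP = (P²-Q)/12`, `DQ = (PQ-R)/3`, `DR = (PR-Q²)/2`. -/
def Dop (f : Poly3) : Poly3 :=
  C (1/12 : ℚ) * (X 0 ^ 2 - X 1) * pderiv 0 f
    + C (1/3 : ℚ) * (X 0 * X 1 - X 2) * pderiv 1 f
    + C (1/2 : ℚ) * (X 0 * X 2 - X 1 ^ 2) * pderiv 2 f

/-- The sum of the `j`-th powers of the divisors of `n`, as a rational number. -/
def sigmaQ (j n : ℕ) : ℚ := ∑ d ∈ n.divisors, (d : ℚ) ^ j

/-- The q-expansion of `E₂`. -/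
def E2s : PowerSeries ℚ := PowerSeries.mk fun n => if n = 0 then 1 else -24 * sigmaQ 1 n

/-- The q-expansion of `E₄`. -/
def E4s : PowerSeries ℚ := PowerSeries.mk fun n => if n = 0 then 1 else 240 * sigmaQ 3 n

/-- The q-expansion of `E₆`. -/
def E6s : PowerSeries ℚ := PowerSeries.mk fun n => if n = 0 then 1 else -504 * sigmaQ 5 n

/-- The q-expansion of the normalized Eisenstein series `E_{p-1}`. -/
def EAs (p : ℕ) : PowerSeries ℚ :=
  PowerSeries.mk fun n => if n = 0 then 1 else
    -(2 * ((p : ℚ) - 1) / bernoulli (p - 1)) * sigmaQ (p - 2) n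

/-- The q-expansion of the normalized Eisenstein series `E_{p+1}`. -/
def EBs (p : ℕ) : PowerSeries ℚ :=
  PowerSeries.mk fun n => if n = 0 then 1 else
    -(2 * ((p : ℚ) + 1) / bernoulli (p + 1)) * sigmaQ p n

/-- `Φ : ℚ[P,Q,R] → ℚ[[q]]`, the algebra map sending `P, Q, R` to `E₂, E₄, E₆`. -/
def Phi : Poly3 →ₐ[ℚ] PowerSeries ℚ := aeval ![E2s, E4s, E6s]

/-- The theta operator attached to the polynomials `A` and `B`:
`θf = ((BQ-AR)/3)·∂f/∂Q + ((BR-AQ²)/2)·∂f/∂R`. -/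
def thetaOp (A B f : Poly3) : Poly3 :=
  C (1/3 : ℚ) * (B * X 1 - A * X 2) * pderiv 1 f
    + C (1/2 : ℚ) * (B * X 2 - A * X 1 ^ 2) * pderiv 2 f

/-- `f` lies in the `n`-th power of the ideal `(A^p, p)` of `ℤ_(p)[P,Q,R]`. -/
def InIdealPow (p : ℕ) (A : Poly3) (n : ℕ) (f : Poly3) : Prop :=
  ∃ G : ℕ → Poly3, (∀ i, polyPInt p (G i)) ∧
    f = ∑ i ∈ Finset.range (n + 1), (p : Poly3) ^ (n - i) * A ^ (p * i) * G i


section Analytic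

open UpperHalfPlane hiding I
open Complex Filter Function
open scoped Real MatrixGroups ModularForm Manifold Topology

/-- `f` has the `q`-expansion `s` on the whole upper half plane. -/
def HasQ (f : ℍ → ℂ) (s : PowerSeries ℂ) : Prop :=
  ∀ τ : ℍ, HasSum (fun m : ℕ => PowerSeries.coeff m s • Periodic.qParam 1 τ ^ m) (f τ)

/-- The theta operator `q d/dq` on power series. -/
def thetaPS {K : Type*} [CommRing K] (s : PowerSeries K) : PowerSeries K :=
  PowerSeries.mk fun n => (n : K) * PowerSeries.coeff n s

lemma HasQ.add {f g : ℍ → ℂ} {s t : PowerSeries ℂ} (hf : HasQ f s) (hg : HasQ g t) :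
    HasQ (f + g) (s + t) := by
  intro τ
  simpa [add_mul] using (hf τ).add (hg τ)

lemma HasQ.smul {f : ℍ → ℂ} {s : PowerSeries ℂ} (c : ℂ) (hf : HasQ f s) :
    HasQ (c • f) (c • s) := by
  intro τ
  simpa [mul_assoc] using (hf τ).mul_left c

lemma HasQ.mul {f g : ℍ → ℂ} {s t : PowerSeries ℂ} (hf : HasQ f s) (hg : HasQ g t) :
    HasQ (f * g) (s * t) := by
  intro τ
  have h1 := (hf τ).summable.norm
  have h2 := (hg τ).summable.norm
  have h3 := tsum_mul_tsum_eq_tsum_sum_antidiagonal_of_summable_norm h1 h2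
  have h4 := summable_norm_sum_mul_antidiagonal_of_summable_norm h1 h2
  rw [(hf τ).tsum_eq, (hg τ).tsum_eq] at h3
  rw [Pi.mul_apply, h3]
  have h5 := h4.of_norm.hasSum
  convert! h5 using 2 with n
  rw [PowerSeries.coeff_mul, Finset.sum_smul]
  refine Finset.sum_congr rfl fun x hx => ?_
  rw [← Finset.HasAntidiagonal.mem_antidiagonal.mp hx, pow_add]
  simp only [smul_eq_mul]; ring

lemma HasQ.deriv {f : ℍ → ℂ} {s : PowerSeries ℂ} (hf : HasQ f s) :
    HasQ (Derivative.normalizedDerivOfComplex f) (thetaPS s) := by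
  intro τ
  set F : ℕ → ℂ → ℂ := fun m w => PowerSeries.coeff m s • Periodic.qParam 1 w ^ m with hF
  let τ0 : ℍ := ⟨I * (τ.im / 2 : ℝ), by simp [τ.im_pos]⟩
  have hu := (hf τ0).summable.norm
  let U : Set ℂ := {w | τ.im / 2 < w.im}
  have hU : IsOpen U := isOpen_lt continuous_const Complex.continuous_im
  have hz : (τ : ℂ) ∈ U := by
    have := τ.im_pos
    simp only [U, Set.mem_ofPred_eq, UpperHalfPlane.coe_im]; linarith
  have hder : ∀ (i : ℕ) (w : ℂ), HasDerivAt (F i)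
      ((2 * π * I) * (i * (PowerSeries.coeff i s • Periodic.qParam 1 w ^ i))) w := by
    intro i w
    have h1 : HasDerivAt (fun w => Periodic.qParam 1 w) (Periodic.qParam 1 w * (2 * π * I)) w := by
      unfold Periodic.qParam
      have := ((hasDerivAt_id w).const_mul (2 * π * I)).cexp
      simpa using this
    have h2 := (h1.fun_pow i).const_mul (PowerSeries.coeff i s)
    convert! h2 using 1
    rcases i with _ | i
    · simp
    · simp [pow_succ]; ring
  have hle : ∀ (i : ℕ) (w : ℂ), w ∈ U →
      ‖F i w‖ ≤ ‖PowerSeries.coeff i s • Periodic.qParam 1 (τ0 : ℂ) ^ i‖ := by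
    intro i w hw
    simp only [hF, norm_smul, norm_pow]
    gcongr
    rw [Periodic.norm_qParam, Periodic.norm_qParam]
    apply Real.exp_le_exp.mpr
    have h0 : (τ0 : ℂ).im = τ.im / 2 := by simp [τ0]
    rw [h0]
    have : τ.im / 2 < w.im := hw
    have hpi := Real.pi_pos
    nlinarith
  have key := hasSum_deriv_of_summable_norm (F := F) hu
    (fun i w hw => (hder i w).differentiableAt.differentiableWithinAt) hU hle hz
  have heq : (fun w : ℂ => ∑' i, F i w) =ᶠ[𝓝 (τ : ℂ)] (f ∘ ofComplex) := by
    filter_upwards [isOpen_upperHalfPlaneSet.mem_nhds τ.im_pos] with w hw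
    have := (hf (ofComplex w)).tsum_eq
    simp only [Function.comp]
    rw [← this]
    simp [hF, ofComplex_apply_of_im_pos hw]
  rw [heq.deriv_eq] at key
  have k2 := key.mul_left ((2 * π * I)⁻¹)
  unfold Derivative.normalizedDerivOfComplex
  convert! k2 using 2 with i
  rw [(hder i τ).deriv, ← mul_assoc, inv_mul_cancel₀ (by simp [Real.pi_ne_zero, Complex.I_ne_zero]), one_mul]
  simp [thetaPS, mul_assoc]

lemma HasQ.eq_zero {s : PowerSeries ℂ} (h : HasQ 0 s) : s = 0 := by
  have h2 : HasQ (0 : ModularForm 𝒮ℒ 4) s := h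
  have h3 : HasQ (0 : ModularForm 𝒮ℒ 4) 0 := fun τ => by simp
  ext m
  rw [ModularFormClass.qExpansion_coeff_unique (F := ModularForm 𝒮ℒ 4) one_pos one_mem_strictPeriods_SL h2 m,
    ModularFormClass.qExpansion_coeff_unique (F := ModularForm 𝒮ℒ 4) one_pos one_mem_strictPeriods_SL h3 m]

lemma modular_vanish (g : ℍ → ℂ) (s : PowerSeries ℂ) (k : ℕ) (hk : k < 12) (hd : MDiff g)
    (hsl : ∀ γ : SL(2, ℤ), g ∣[(k : ℤ)] γ = g) (hq : HasQ g s)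
    (h0 : PowerSeries.coeff 0 s = 0) : s = 0 := by
  have hb : IsBoundedAtImInfty g := isBoundedAtImInfty_of_hasSum_qExpansion one_pos hq
  let G : ModularForm 𝒮ℒ (k : ℤ) :=
    { toFun := g
      slash_action_eq' := by
        rintro _ ⟨γ, rfl⟩
        exact hsl γ
      holo' := hd
      bdd_at_cusps' := by
        intro c hc
        rw [OnePoint.isBoundedAt_iff_forall_SL2Z hc]
        intro γ _
        rw [hsl γ]
        exact hb }
  have hG : HasQ G s := hq
  have hs : ∀ m, PowerSeries.coeff m s = PowerSeries.coeff m (qExpansion 1 G) := fun m =>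
    ModularFormClass.qExpansion_coeff_unique one_pos one_mem_strictPeriods_SL hG m
  have hG0 : G = 0 := by
    apply ModularForm.sturm_bound_levelOne_nat
    rw [Nat.div_eq_of_lt hk]
    simp only [Nat.cast_zero]
    rw [pos_iff_ne_zero]
    rw [PowerSeries.order_ne_zero_iff_constCoeff_eq_zero, ← PowerSeries.coeff_zero_eq_constantCoeff_apply, ← hs 0, h0]
  have : HasQ 0 s := by
    rw [hG0] at hG
    exact hG
  exact this.eq_zero

end Analytic

section Ramanujan

open UpperHalfPlane hiding I
open Complex Filter Function
open scoped Real MatrixGroups ModularForm Manifold Topology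

lemma sigmaQ_cast (j n : ℕ) : ((sigmaQ j n : ℚ) : ℂ) = (ArithmeticFunction.sigma j n : ℂ) := by
  simp [sigmaQ, ArithmeticFunction.sigma_apply]

lemma bddE {k : ℤ} (f : ModularForm 𝒮ℒ k) : IsBoundedAtImInfty f :=
  have : Fact (IsCusp OnePoint.infty 𝒮ℒ) :=
    ⟨Subgroup.isCusp_of_mem_strictPeriods one_pos one_mem_strictPeriods_SL⟩
  ModularFormClass.bdd_at_infty f

lemma hasQ_E2 : HasQ EisensteinSeries.E2 (PowerSeries.map (algebraMap ℚ ℂ) E2s) := by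
  intro τ
  have := EisensteinSeries.hasSum_qExpansion_E2 (z := τ)
  simp only [E2s, PowerSeries.coeff_map, PowerSeries.coeff_mk]
  convert! this using 2 with m
  split_ifs
  · simp [Periodic.qParam]
  · simp [Periodic.qParam, sigmaQ_cast]

lemma hasQ_E4 : HasQ ModularForm.E₄ (PowerSeries.map (algebraMap ℚ ℂ) E4s) := by
  intro τ
  have := hasSum_qExpansion one_pos
    (SlashInvariantFormClass.periodic_comp_ofComplex ModularForm.E₄ one_mem_strictPeriods_SL)
    (ModularFormClass.holo ModularForm.E₄) (bddE ModularForm.E₄) τ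
  convert! this using 3 with m
  rw [EisensteinSeries.E_qExpansion_coeff (by norm_num) (by decide)]
  simp only [E4s, PowerSeries.coeff_map, PowerSeries.coeff_mk]
  split_ifs
  · simp
  · have : bernoulli 4 = -1/30 := by
      rw [bernoulli_eq_bernoulli'_of_ne_one (by norm_num), bernoulli'_four]
    rw [this]
    simp [sigmaQ_cast]
    ring

lemma hasQ_E6 : HasQ ModularForm.E₆ (PowerSeries.map (algebraMap ℚ ℂ) E6s) := by
  intro τ
  have := hasSum_qExpansion one_pos
    (SlashInvariantFormClass.periodic_comp_ofComplex ModularForm.E₆ one_mem_strictPeriods_SL)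
    (ModularFormClass.holo ModularForm.E₆) (bddE ModularForm.E₆) τ
  convert! this using 3 with m
  rw [EisensteinSeries.E_qExpansion_coeff (by norm_num) (by decide)]
  simp only [E6s, PowerSeries.coeff_map, PowerSeries.coeff_mk]
  split_ifs
  · simp
  · have : bernoulli 6 = 1/42 := by
      rw [bernoulli_eq_bernoulli'_of_ne_one (by norm_num)]
      rw [bernoulli'_def]
      have h5 : bernoulli' 5 = 0 := bernoulli'_eq_zero_of_odd (by decide) (by norm_num)
      norm_num [Finset.sum_range_succ, bernoulli'_zero, bernoulli'_one, bernoulli'_two, bernoulli'_three, bernoulli'_four, h5, Nat.choose]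
    rw [this]
    simp [sigmaQ_cast]
    left; norm_num

lemma thetaPS_map {K L : Type*} [CommRing K] [CommRing L] (φ : K →+* L) (s : PowerSeries K) :
    thetaPS (PowerSeries.map φ s) = PowerSeries.map φ (thetaPS s) := by
  ext n; simp [thetaPS]

lemma map_inj_QC {s t : PowerSeries ℚ} (h : PowerSeries.map (algebraMap ℚ ℂ) s =
    PowerSeries.map (algebraMap ℚ ℂ) t) : s = t := by
  ext n
  have := congrArg (PowerSeries.coeff n) h
  simpa using this

lemma constCoeff_map_QC (s : PowerSeries ℚ) :
    PowerSeries.constantCoeff (PowerSeries.map (algebraMap ℚ ℂ) s) =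
      ((PowerSeries.constantCoeff s : ℚ) : ℂ) := by
  rw [← PowerSeries.coeff_zero_eq_constantCoeff_apply, PowerSeries.coeff_map,
    PowerSeries.coeff_zero_eq_constantCoeff_apply]
  rfl

lemma slash_DE2 (γ : SL(2, ℤ)) :
    (Derivative.normalizedDerivOfComplex EisensteinSeries.E2 +
      (-1 / 12 : ℂ) • (EisensteinSeries.E2 * EisensteinSeries.E2)) ∣[(4 : ℤ)] γ =
    Derivative.normalizedDerivOfComplex EisensteinSeries.E2 +
      (-1 / 12 : ℂ) • (EisensteinSeries.E2 * EisensteinSeries.E2) := by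
  have h1 := Derivative.normalizedDerivOfComplex_SL_slash (k := 2) E2_mdifferentiable (γ := γ)
  have h2 := EisensteinSeries.E2_slash_action γ
  have h3 := ModularForm.mul_slash_SL2 2 2 γ EisensteinSeries.E2 EisensteinSeries.E2
  norm_num at h1 h3
  rw [SlashAction.add_slash, ModularForm.SL_smul_slash, h3]
  rw [h2] at h1 ⊢
  ext z
  have hz := denom_ne_zero γ z
  have hd : HasDerivAt (fun w : ℂ => denom γ w ^ (-1 : ℤ))
      (-(γ 1 0 : ℂ) * (denom γ z) ^ (-2 : ℤ)) (z : ℂ) := by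
    simpa using hasDerivAt_denom_zpow γ (-1) z
  have hE : HasDerivAt (EisensteinSeries.E2 ∘ ofComplex)
      (deriv (EisensteinSeries.E2 ∘ ofComplex) (z : ℂ)) (z : ℂ) :=
    (mdifferentiableAt_iff.mp (E2_mdifferentiable z)).hasDerivAt
  have hc : ((EisensteinSeries.E2 - (1 / (2 * riemannZeta 2)) • EisensteinSeries.D2 γ) ∘ ofComplex)
      =ᶠ[𝓝 (z : ℂ)] fun w => (EisensteinSeries.E2 ∘ ofComplex) w -
        (1 / (2 * riemannZeta 2)) * ((2 * π * I * γ 1 0) * denom γ w ^ (-1 : ℤ)) := by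
    filter_upwards [isOpen_upperHalfPlaneSet.mem_nhds z.im_pos] with w hw
    simp [EisensteinSeries.D2, ofComplex_apply_of_im_pos hw, div_eq_mul_inv]
  have hD : Derivative.normalizedDerivOfComplex
      (EisensteinSeries.E2 - (1 / (2 * riemannZeta 2)) • EisensteinSeries.D2 γ) z =
      Derivative.normalizedDerivOfComplex EisensteinSeries.E2 z -
      (2 * π * I)⁻¹ * ((1 / (2 * riemannZeta 2)) * ((2 * π * I * γ 1 0) *
        (-(γ 1 0 : ℂ) * (denom γ z) ^ (-2 : ℤ)))) := by
    unfold Derivative.normalizedDerivOfComplex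
    rw [((hE.sub ((hd.const_mul _).const_mul _)).congr_of_eventuallyEq hc).deriv]
    ring
  have h4 := congrFun h1 z
  rw [hD] at h4
  have hpi : (π : ℂ) ≠ 0 := by exact_mod_cast Real.pi_ne_zero
  have hI : I ^ 2 = -1 := I_sq
  simp only [Pi.sub_apply, Pi.add_apply, Pi.smul_apply, Pi.mul_apply, smul_eq_mul,
    EisensteinSeries.D2, riemannZeta_two] at h4 ⊢
  have h5 := eq_add_of_sub_eq h4.symm
  norm_num only [Int.cast_ofNat] at h5 ⊢
  rw [h5]
  rw [zpow_neg]
  field_simp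
  ring_nf
  simp only [hI]
  ring

/-- The Ramanujan identity for the derivative of `E₂`. -/
lemma ram2 : thetaPS E2s = (1 / 12 : ℚ) • (E2s ^ 2 - E4s) := by
  have hq := ((hasQ_E2.deriv).add ((hasQ_E2.mul hasQ_E2).smul (-1 / 12))).add (hasQ_E4.smul (1 / 12))
  have := modular_vanish _ _ 4 (by norm_num) ?_ ?_ hq ?_
  · apply map_inj_QC
    rw [thetaPS_map, add_assoc, add_eq_zero_iff_eq_neg] at this
    rw [this]
    rw [← map_mul, pow_two]
    generalize E2s * E2s = u
    ext n
    simp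
    ring
  · refine ((Derivative.normalizedDerivOfComplex_mdifferentiable E2_mdifferentiable).add
      ((E2_mdifferentiable.mul E2_mdifferentiable).const_smul _)).add
      ((ModularFormClass.holo ModularForm.E₄).const_smul _)
  · intro γ
    push_cast
    rw [SlashAction.add_slash, slash_DE2, ModularForm.SL_smul_slash]
    congr 2
    exact SlashInvariantForm.slash_action_eqn ModularForm.E₄ _ ⟨γ, rfl⟩
  · have e2 : PowerSeries.coeff 0 E2s = 1 := by simp [E2s]
    have e4 : PowerSeries.coeff 0 E4s = 1 := by simp [E4s]
    rw [PowerSeries.coeff_zero_eq_constantCoeff_apply] at e2 e4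
    simp [thetaPS, e2, e4, constCoeff_map_QC]
    norm_num

lemma serre_id (f g : ℍ → ℂ) (s t : PowerSeries ℚ) (k : ℕ) (hk : k + 2 < 12) (c : ℚ)
    (hf : MDiff f) (hg : MDiff g) (hfs : ∀ γ : SL(2, ℤ), f ∣[(k : ℤ)] γ = f)
    (hgs : ∀ γ : SL(2, ℤ), g ∣[((k + 2 : ℕ) : ℤ)] γ = g)
    (qf : HasQ f (PowerSeries.map (algebraMap ℚ ℂ) s))
    (qg : HasQ g (PowerSeries.map (algebraMap ℚ ℂ) t))
    (s0 : PowerSeries.coeff 0 s = 1) (t0 : PowerSeries.coeff 0 t = 1) (hc : c = k / 12) :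
    thetaPS s = c • (E2s * s - t) := by
  have hq := ((qf.deriv).add ((hasQ_E2.mul qf).smul (-c))).add (qg.smul c)
  have := modular_vanish _ _ (k + 2) (by omega) ?_ ?_ hq ?_
  · apply map_inj_QC
    rw [thetaPS_map, add_assoc, add_eq_zero_iff_eq_neg] at this
    rw [this]
    rw [← map_mul]
    generalize E2s * s = u
    ext n
    simp
    ring
  · exact ((Derivative.normalizedDerivOfComplex_mdifferentiable hf).add
      ((E2_mdifferentiable.mul hf).const_smul _)).add (hg.const_smul _)
  · intro γ
    rw [SlashAction.add_slash, ModularForm.SL_smul_slash, hgs]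
    congr 1
    have h1 := Derivative.serreDerivative_slash_invariant (k := k) hf (hfs γ)
    have h2 : Derivative.serreDerivative ((k : ℤ) : ℂ) f =
        Derivative.normalizedDerivOfComplex f + (-(c : ℂ)) • (EisensteinSeries.E2 * f) := by
      ext z
      simp [hc]
      ring
    rw [h2] at h1
    exact_mod_cast h1
  · have e0 : PowerSeries.coeff 0 E2s = 1 := by simp [E2s]
    rw [PowerSeries.coeff_zero_eq_constantCoeff_apply] at e0 s0 t0
    simp [thetaPS, e0, s0, t0, constCoeff_map_QC]

lemma slashE {k : ℕ} (f : ModularForm 𝒮ℒ (k : ℤ)) (γ : SL(2, ℤ)) : (f : ℍ → ℂ) ∣[(k : ℤ)] γ = f :=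
  SlashInvariantForm.slash_action_eqn f _ ⟨γ, rfl⟩

/-- The Ramanujan identity for the derivative of `E₄`. -/
lemma ram4 : thetaPS E4s = (1 / 3 : ℚ) • (E2s * E4s - E6s) :=
  serre_id _ _ E4s E6s 4 (by norm_num) _ (ModularFormClass.holo ModularForm.E₄)
    (ModularFormClass.holo ModularForm.E₆) (slashE ModularForm.E₄) (slashE ModularForm.E₆)
    hasQ_E4 hasQ_E6 (by simp [E4s]) (by simp [E6s]) (by norm_num)

/-- The Ramanujan identity for the derivative of `E₆`. -/
lemma ram6 : thetaPS E6s = (1 / 2 : ℚ) • (E2s * E6s - E4s ^ 2) := by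
  rw [pow_two]
  refine serre_id _ _ E6s (E4s * E4s) 6 (by norm_num) _ (ModularFormClass.holo ModularForm.E₆)
    ((ModularFormClass.holo ModularForm.E₄).mul (ModularFormClass.holo ModularForm.E₄))
    (slashE ModularForm.E₆) ?_
    hasQ_E6 ?_ (by simp [E6s]) (by simp [E4s]) (by norm_num)
  · intro γ
    have := ModularForm.mul_slash_SL2 4 4 γ ModularForm.E₄ ModularForm.E₄
    norm_num at this
    have h2 := slashE ModularForm.E₄ γ
    push_cast at h2 ⊢
    rw [h2] at this
    exact this
  · rw [map_mul]
    exact hasQ_E4.mul hasQ_E4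

end Ramanujan

section Formal

variable {K : Type*} [CommRing K]

/-- The weights of the three variables. -/
def wt : Fin 3 → ℕ := ![2, 4, 6]

/-- The Ramanujan derivation over a ring in which `c` plays the role of `1/12`. -/
def DK (c : K) : Derivation K (MvPolynomial (Fin 3) K) (MvPolynomial (Fin 3) K) :=
  mkDerivation K ![C c * (X 0 ^ 2 - X 1), C (4 * c) * (X 0 * X 1 - X 2),
    C (6 * c) * (X 0 * X 2 - X 1 ^ 2)]

lemma DK_X0 (c : K) : DK c (X 0) = C c * (X 0 ^ 2 - X 1) := by simp [DK, mkDerivation_X]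
lemma DK_X1 (c : K) : DK c (X 1) = C (4 * c) * (X 0 * X 1 - X 2) := by
  rw [DK, mkDerivation_X]; simp
lemma DK_X2 (c : K) : DK c (X 2) = C (6 * c) * (X 0 * X 2 - X 1 ^ 2) := by
  rw [DK, mkDerivation_X]; simp

/-- The Euler (weight) derivation. -/
def HK (K : Type*) [CommRing K] : Derivation K (MvPolynomial (Fin 3) K) (MvPolynomial (Fin 3) K) :=
  mkDerivation K fun i => C (wt i : K) * X i

lemma HK_X (i : Fin 3) : HK K (X i) = C (wt i : K) * X i := by rw [HK, mkDerivation_X]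

lemma DK_apply (c : K) (f : MvPolynomial (Fin 3) K) :
    DK c f = C c * (X 0 ^ 2 - X 1) * pderiv 0 f + C (4 * c) * (X 0 * X 1 - X 2) * pderiv 1 f
      + C (6 * c) * (X 0 * X 2 - X 1 ^ 2) * pderiv 2 f := by
  have : DK c = (C c * (X 0 ^ 2 - X 1) : MvPolynomial (Fin 3) K) • pderiv (R := K) (0 : Fin 3)
      + (C (4 * c) * (X 0 * X 1 - X 2) : MvPolynomial (Fin 3) K) • pderiv (R := K) (1 : Fin 3)
      + (C (6 * c) * (X 0 * X 2 - X 1 ^ 2) : MvPolynomial (Fin 3) K) •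
        pderiv (R := K) (2 : Fin 3) := by
    apply derivation_ext
    intro i
    fin_cases i <;> simp [DK_X0, DK_X1, DK_X2, pderiv_X]
  rw [this]; simp

lemma HK_apply (f : MvPolynomial (Fin 3) K) :
    HK K f = ∑ i, wt i • (X i * pderiv i f) := by
  have : HK K = (∑ i, (C (wt i : K) * X i) • pderiv i) := by
    apply derivation_ext
    intro i
    simp only [HK_X, Fin.sum_univ_three]
    fin_cases i <;> simp [pderiv_X]
  rw [this]
  simp [Fin.sum_univ_three, mul_assoc]

lemma Dop_eq (f : Poly3) : Dop f = DK (1 / 12 : ℚ) f := by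
  rw [DK_apply, Dop]; norm_num

lemma DK_map {L : Type*} [CommRing L] (φ : K →+* L) (c : K) (f : MvPolynomial (Fin 3) K) :
    map φ (DK c f) = DK (φ c) (map φ f) := by
  simp only [DK_apply, pderiv_map, map_add, map_mul, map_sub, map_pow, map_C, map_X, map_ofNat]

lemma DK_iter_map {L : Type*} [CommRing L] (φ : K →+* L) (c : K) (n : ℕ)
    (f : MvPolynomial (Fin 3) K) :
    map φ ((DK c)^[n] f) = (DK (φ c))^[n] (map φ f) := by
  induction n generalizing f with
  | zero => rfl
  | succ n ih => simp only [Function.iterate_succ_apply, ih, DK_map]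

lemma pderiv_iter_map {L : Type*} [CommRing L] (φ : K →+* L) (n : ℕ)
    (f : MvPolynomial (Fin 3) K) :
    map φ ((pderiv 0)^[n] f) = (pderiv 0)^[n] (map φ f) := by
  induction n generalizing f with
  | zero => rfl
  | succ n ih => simp only [Function.iterate_succ_apply, ih, pderiv_map]

lemma comm_pD (c : K) (f : MvPolynomial (Fin 3) K) :
    pderiv 0 (DK c f) = DK c (pderiv 0 f) + C c * HK K f := by
  have : ⁅(pderiv 0 : Derivation K (MvPolynomial (Fin 3) K) (MvPolynomial (Fin 3) K)), DK c⁆ =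
      (C c : MvPolynomial (Fin 3) K) • HK K := by
    apply derivation_ext
    intro i
    rw [Derivation.commutator_apply]
    fin_cases i
    · simp [DK_X0, HK_X, wt, pderiv_X, Derivation.leibniz_pow]
      rw [show (C 2 : MvPolynomial (Fin 3) K) = 2 from map_ofNat C 2]
    · simp [DK_X1, HK_X, wt, pderiv_X]; ring
    · simp [DK_X2, HK_X, wt, pderiv_X]; ring
  have h := congrArg (fun d => d f) this
  simp only [Derivation.commutator_apply, Derivation.smul_apply, smul_eq_mul] at h
  rw [← h]; ring

lemma comm_HD (c : K) (f : MvPolynomial (Fin 3) K) :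
    HK K (DK c f) = DK c (HK K f) + C 2 * DK c f := by
  have c2 : (C 2 : MvPolynomial (Fin 3) K) = 2 := map_ofNat C 2
  have c4 : (C 4 : MvPolynomial (Fin 3) K) = 4 := map_ofNat C 4
  have c6 : (C 6 : MvPolynomial (Fin 3) K) = 6 := map_ofNat C 6
  have : ⁅HK K, DK c⁆ = (C 2 : MvPolynomial (Fin 3) K) • DK c := by
    apply derivation_ext
    intro i
    rw [Derivation.commutator_apply]
    fin_cases i
    · simp [DK_X0, HK_X, wt, Derivation.leibniz_pow]; simp only [c2, c4, c6]; ring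
    · simp [DK_X1, HK_X, wt]; simp only [c2, c4, c6]; ring
    · simp [DK_X2, HK_X, wt, Derivation.leibniz_pow]; simp only [c2, c4, c6]; ring
  have h := congrArg (fun d => d f) this
  simp only [Derivation.commutator_apply, Derivation.smul_apply, smul_eq_mul] at h
  rw [← h]; ring

lemma DK_C_mul (c a : K) (f : MvPolynomial (Fin 3) K) : DK c (C a * f) = C a * DK c f := by
  simp

lemma iter_add (d : Derivation K (MvPolynomial (Fin 3) K) (MvPolynomial (Fin 3) K)) (n : ℕ)
    (f g : MvPolynomial (Fin 3) K) : d^[n] (f + g) = d^[n] f + d^[n] g := by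
  induction n generalizing f g with
  | zero => rfl
  | succ n ih => simp only [Function.iterate_succ_apply, map_add, ih]

lemma iter_C_mul (d : Derivation K (MvPolynomial (Fin 3) K) (MvPolynomial (Fin 3) K)) (n : ℕ)
    (a : K) (f : MvPolynomial (Fin 3) K) : d^[n] (C a * f) = C a * d^[n] f := by
  induction n generalizing f with
  | zero => rfl
  | succ n ih =>
    have : d (C a * f) = C a * d f := by simp
    rw [Function.iterate_succ_apply, Function.iterate_succ_apply, this, ih]

lemma iter_zero (d : Derivation K (MvPolynomial (Fin 3) K) (MvPolynomial (Fin 3) K)) (n : ℕ) :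
    d^[n] 0 = 0 := by
  induction n with
  | zero => rfl
  | succ n ih => simp only [Function.iterate_succ_apply, map_zero, ih]

lemma pderiv_D_iter (c : K) (n : ℕ) (f : MvPolynomial (Fin 3) K) :
    pderiv 0 ((DK c)^[n + 1] f) = (DK c)^[n + 1] (pderiv 0 f)
      + C ((n + 1 : ℕ) * c) * (DK c)^[n] (HK K f + C (n : K) * f) := by
  induction n generalizing f with
  | zero =>
    have e : ∀ g, (DK c)^[0 + 1] g = DK c g := fun g => rfl
    rw [e, e, comm_pD]
    simp
  | succ n ih =>
    have e0 : (DK c)^[n + 1 + 1] (pderiv 0 f) = (DK c)^[n + 1] (DK c (pderiv 0 f)) :=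
      Function.iterate_succ_apply _ _ _
    have e1 : (DK c)^[n + 1 + 1] f = (DK c)^[n + 1] (DK c f) := Function.iterate_succ_apply _ _ _
    have e2 : (DK c)^[n + 1] f = (DK c)^[n] (DK c f) := Function.iterate_succ_apply _ _ _
    have e3 : (DK c)^[n + 1] (HK K f) = (DK c)^[n] (DK c (HK K f)) := Function.iterate_succ_apply _ _ _
    rw [e0, e1, ih, comm_pD, comm_HD]
    simp only [iter_add, iter_C_mul]
    rw [e2, e3]
    generalize (DK c)^[n] (DK c f) = u
    generalize (DK c)^[n] (DK c (HK K f)) = v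
    generalize (DK c)^[n + 1] (DK c (pderiv 0 f)) = w
    have c2 : (C 2 : MvPolynomial (Fin 3) K) = 2 := map_ofNat C 2
    simp only [Nat.cast_add, Nat.cast_one, map_add, map_mul, map_one, c2]
    ring

lemma pderiv_D_iter_of (c : K) (n k : ℕ) (f : MvPolynomial (Fin 3) K) (h0 : pderiv 0 f = 0)
    (hk : HK K f = C (k : K) * f) :
    pderiv 0 ((DK c)^[n + 1] f) = C (((n + 1) * (k + n) : ℕ) * c) * (DK c)^[n] f := by
  rw [pderiv_D_iter, h0, hk, iter_zero, ← add_mul, ← C_add, iter_C_mul, ← mul_assoc, ← C_mul,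
    zero_add]
  congr 2
  push_cast; ring

lemma pderiv_iter_D_iter (c : K) (i n k : ℕ) (hi : i ≤ n) (f : MvPolynomial (Fin 3) K)
    (h0 : pderiv 0 f = 0) (hk : HK K f = C (k : K) * f) :
    (pderiv 0)^[i] ((DK c)^[n] f) =
      C ((n.descFactorial i * (k + n - 1).descFactorial i : ℕ) * c ^ i) * (DK c)^[n - i] f := by
  induction i with
  | zero => simp
  | succ i ih =>
    rw [Function.iterate_succ_apply', ih (by omega)]
    obtain ⟨m, rfl⟩ : ∃ m, n = m + 1 + i := ⟨n - 1 - i, by omega⟩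
    have e1 : m + 1 + i - i = m + 1 := by omega
    have e2 : m + 1 + i - (i + 1) = m := by omega
    have e3 : k + (m + 1 + i) - 1 - i = k + m := by omega
    rw [pderiv_C_mul, Nat.descFactorial_succ, Nat.descFactorial_succ, e1, e2, e3,
      pderiv_D_iter_of c m k f h0 hk, ← mul_assoc, ← C_mul]
    congr 2
    push_cast; ring

lemma HK_of_wh {f : MvPolynomial (Fin 3) K} {n : ℕ} (h : IsWeightedHomogeneous wt f n) :
    HK K f = C (n : K) * f := by
  rw [HK_apply, h.sum_weight_X_mul_pderiv]; simp

lemma wh_mul_pderiv {f g : MvPolynomial (Fin 3) K} {n a b : ℕ} {i : Fin 3}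
    (h : IsWeightedHomogeneous wt f n) (hg : IsWeightedHomogeneous wt g a) (hab : a = wt i + b) :
    IsWeightedHomogeneous wt (g * pderiv i f) (n + b) := by
  by_cases hn : wt i ≤ n
  · have := hg.mul (h.pderiv (i := i) (n' := n - wt i) (by omega))
    convert this using 1; omega
  · have : pderiv i f = 0 := by
      ext m
      rw [coeff_pderiv]
      by_contra h1
      have h2 : coeff (m + Finsupp.single i 1) f ≠ 0 := by
        intro h3; apply h1; simp [h3]
      have h3 := h h2
      rw [map_add, Finsupp.weight_single, one_smul] at h3
      omega
    rw [this, mul_zero]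
    exact isWeightedHomogeneous_zero _ _ _

lemma wh_X (i : Fin 3) : IsWeightedHomogeneous wt (X i : MvPolynomial (Fin 3) K) (wt i) :=
  isWeightedHomogeneous_X _ _ _

lemma wh_sub {f g : MvPolynomial (Fin 3) K} {n : ℕ} (hf : IsWeightedHomogeneous wt f n)
    (hg : IsWeightedHomogeneous wt g n) : IsWeightedHomogeneous wt (f - g) n :=
  Submodule.sub_mem (weightedHomogeneousSubmodule K wt n) hf hg

lemma wh_C_mul {f : MvPolynomial (Fin 3) K} {n : ℕ} (a : K) (hf : IsWeightedHomogeneous wt f n) :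
    IsWeightedHomogeneous wt (C a * f) n := by
  rw [← smul_eq_C_mul]
  exact Submodule.smul_mem (weightedHomogeneousSubmodule K wt n) a hf

lemma wh_D (c : K) {f : MvPolynomial (Fin 3) K} {n : ℕ} (h : IsWeightedHomogeneous wt f n) :
    IsWeightedHomogeneous wt (DK c f) (n + 2) := by
  rw [DK_apply]
  have h0 : IsWeightedHomogeneous wt (X 0 ^ 2 - X 1 : MvPolynomial (Fin 3) K) 4 :=
    wh_sub (by rw [pow_two]; exact (wh_X 0).mul (wh_X 0)) (wh_X 1)
  have h1 : IsWeightedHomogeneous wt (X 0 * X 1 - X 2 : MvPolynomial (Fin 3) K) 6 :=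
    wh_sub ((wh_X 0).mul (wh_X 1)) (wh_X 2)
  have h2 : IsWeightedHomogeneous wt (X 0 * X 2 - X 1 ^ 2 : MvPolynomial (Fin 3) K) 8 :=
    wh_sub ((wh_X 0).mul (wh_X 2)) (by rw [pow_two]; exact (wh_X 1).mul (wh_X 1))
  exact ((wh_mul_pderiv h (wh_C_mul _ h0) (by simp [wt])).add
    (wh_mul_pderiv h (wh_C_mul _ h1) (by simp [wt]))).add
    (wh_mul_pderiv h (wh_C_mul _ h2) (by simp [wt]))

lemma wh_D_iter (c : K) {f : MvPolynomial (Fin 3) K} {n : ℕ} (h : IsWeightedHomogeneous wt f n)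
    (i : ℕ) : IsWeightedHomogeneous wt ((DK c)^[i] f) (n + 2 * i) := by
  induction i with
  | zero => exact h
  | succ i ih =>
    rw [Function.iterate_succ_apply']
    exact wh_D c ih

lemma wh_weight {f : MvPolynomial (Fin 3) K} {n : ℕ} (h : IsWeightedHomogeneous wt f n)
    {m : Fin 3 →₀ ℕ} (hm : coeff m f ≠ 0) : 2 * m 0 + 4 * m 1 + 6 * m 2 = n := by
  have := h hm
  rw [Finsupp.weight_apply, Finsupp.sum_fintype _ _ (by simp)] at this
  simp [Fin.sum_univ_three, wt] at this
  omega

lemma wh_of {f : MvPolynomial (Fin 3) K} {n : ℕ}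
    (h : ∀ m, coeff m f ≠ 0 → 2 * m 0 + 4 * m 1 + 6 * m 2 = n) :
    IsWeightedHomogeneous wt f n := by
  intro m hm
  have := h m hm
  rw [Finsupp.weight_apply, Finsupp.sum_fintype _ _ (by simp)]
  simp [Fin.sum_univ_three, wt]
  omega

lemma coeff_pderiv_iter (i : ℕ) (f : MvPolynomial (Fin 3) K) (m : Fin 3 →₀ ℕ) :
    coeff m ((pderiv 0)^[i] f) = ((m 0 + i).descFactorial i : ℕ) *
      coeff (m + Finsupp.single 0 i) f := by
  induction i generalizing f with
  | zero => simp
  | succ i ih =>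
    rw [Function.iterate_succ_apply, ih, coeff_pderiv, add_assoc, ← Finsupp.single_add,
      ← add_assoc, Nat.succ_descFactorial_succ]
    simp
    ring

/-- In characteristic `p`, a polynomial killed by `∂/∂P` involves only `P^p`. -/
lemma dvd_of_pderiv_zero {p : ℕ} [Fact p.Prime] {f : MvPolynomial (Fin 3) (ZMod p)}
    (h : pderiv 0 f = 0) {m : Fin 3 →₀ ℕ} (hm : coeff m f ≠ 0) : p ∣ m 0 := by
  by_contra hd
  have h0 : m 0 ≠ 0 := by rintro h0; exact hd (h0 ▸ dvd_zero _)
  have h1 := congrArg (coeff (m - Finsupp.single 0 1)) h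
  rw [coeff_pderiv, tsub_add_cancel_of_le (by simpa using Nat.one_le_iff_ne_zero.mpr h0)] at h1
  simp only [coeff_zero, mul_eq_zero, hm, false_or] at h1
  apply hd
  rw [← ZMod.natCast_eq_zero_iff, ← h1]
  rw [Finsupp.tsub_apply, Finsupp.single_eq_same, Nat.cast_sub (by omega)]
  simp

end Formal

section QExp

/-- Integral version of the divisor sum. -/
def sigmaZ (j n : ℕ) : ℤ := ∑ d ∈ n.divisors, (d : ℤ) ^ j

/-- Eisenstein-type series over an arbitrary ring. -/
def Eg (K : Type*) [CommRing K] (a : ℤ) (j : ℕ) : PowerSeries K :=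
  PowerSeries.mk fun n => if n = 0 then 1 else ((a * sigmaZ j n : ℤ) : K)

lemma sigmaZ_cast (j n : ℕ) : ((sigmaZ j n : ℤ) : ℚ) = sigmaQ j n := by
  simp [sigmaZ, sigmaQ]

lemma Eg2 : Eg ℚ (-24) 1 = E2s := by ext n; simp [Eg, E2s, sigmaZ_cast]
lemma Eg4 : Eg ℚ 240 3 = E4s := by ext n; simp [Eg, E4s, sigmaZ_cast]
lemma Eg6 : Eg ℚ (-504) 5 = E6s := by ext n; simp [Eg, E6s, sigmaZ_cast]

lemma Eg_map {K L : Type*} [CommRing K] [CommRing L] (φ : K →+* L) (a : ℤ) (j : ℕ) :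
    PowerSeries.map φ (Eg K a j) = Eg L a j := by
  ext n; simp only [Eg, PowerSeries.coeff_map, PowerSeries.coeff_mk]; split_ifs <;> simp

/-- The `q`-expansion homomorphism over an arbitrary ring. -/
def PhiK (K : Type*) [CommRing K] : MvPolynomial (Fin 3) K →ₐ[K] PowerSeries K :=
  aeval ![Eg K (-24) 1, Eg K 240 3, Eg K (-504) 5]

variable {K : Type*} [CommRing K]

lemma PhiK_X0 : PhiK K (X 0) = Eg K (-24) 1 := by simp [PhiK]
lemma PhiK_X1 : PhiK K (X 1) = Eg K 240 3 := by simp [PhiK]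
lemma PhiK_X2 : PhiK K (X 2) = Eg K (-504) 5 := by simp [PhiK]

lemma PhiK_C (a : K) : PhiK K (C a) = PowerSeries.C a := by
  rw [PhiK, aeval_C]; rfl

lemma Phi_eq : Phi = PhiK ℚ := by
  rw [Phi, PhiK, Eg2, Eg4, Eg6]

lemma PhiK_map {L : Type*} [CommRing L] (φ : K →+* L) (f : MvPolynomial (Fin 3) K) :
    PhiK L (map φ f) = PowerSeries.map φ (PhiK K f) := by
  induction f using MvPolynomial.induction_on with
  | C a => rw [map_C, PhiK_C, PhiK_C, PowerSeries.map_C]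
  | add f g hf hg => simp only [map_add, hf, hg]
  | mul_X f i hf =>
    rw [map_mul, map_mul, map_mul, map_mul, hf, map_X]
    congr 1
    fin_cases i
    · exact PhiK_X0.trans (by rw [← Eg_map φ]; exact congrArg _ PhiK_X0.symm)
    · exact PhiK_X1.trans (by rw [← Eg_map φ]; exact congrArg _ PhiK_X1.symm)
    · exact PhiK_X2.trans (by rw [← Eg_map φ]; exact congrArg _ PhiK_X2.symm)

lemma map_inj_ZQ {s t : PowerSeries ℤ} (h : PowerSeries.map (Int.castRingHom ℚ) s =
    PowerSeries.map (Int.castRingHom ℚ) t) : s = t := by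
  ext n
  have := congrArg (PowerSeries.coeff n) h
  simpa using this

lemma ramz2 : (12 : PowerSeries K) * thetaPS (Eg K (-24) 1) = Eg K (-24) 1 ^ 2 - Eg K 240 3 := by
  have h : (12 : PowerSeries ℤ) * thetaPS (Eg ℤ (-24) 1) = Eg ℤ (-24) 1 ^ 2 - Eg ℤ 240 3 := by
    apply map_inj_ZQ
    simp only [map_mul, map_sub, map_pow, ← thetaPS_map, Eg_map, Eg2, Eg4, ram2, map_ofNat]
    rw [PowerSeries.smul_eq_C_mul, ← mul_assoc, ← map_ofNat (PowerSeries.C (R := ℚ)) 12, ← map_mul]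
    norm_num
  have h2 := congrArg (PowerSeries.map (Int.castRingHom K)) h
  simpa only [map_mul, map_sub, map_pow, ← thetaPS_map, Eg_map, map_ofNat] using h2

lemma ramz4 : (3 : PowerSeries K) * thetaPS (Eg K 240 3) =
    Eg K (-24) 1 * Eg K 240 3 - Eg K (-504) 5 := by
  have h : (3 : PowerSeries ℤ) * thetaPS (Eg ℤ 240 3) =
      Eg ℤ (-24) 1 * Eg ℤ 240 3 - Eg ℤ (-504) 5 := by
    apply map_inj_ZQ
    simp only [map_mul, map_sub, ← thetaPS_map, Eg_map, Eg2, Eg4, Eg6, ram4, map_ofNat]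
    rw [PowerSeries.smul_eq_C_mul, ← mul_assoc, ← map_ofNat (PowerSeries.C (R := ℚ)) 3, ← map_mul]
    norm_num
  have h2 := congrArg (PowerSeries.map (Int.castRingHom K)) h
  simpa only [map_mul, map_sub, map_pow, ← thetaPS_map, Eg_map, map_ofNat] using h2

lemma ramz6 : (2 : PowerSeries K) * thetaPS (Eg K (-504) 5) =
    Eg K (-24) 1 * Eg K (-504) 5 - Eg K 240 3 ^ 2 := by
  have h : (2 : PowerSeries ℤ) * thetaPS (Eg ℤ (-504) 5) =
      Eg ℤ (-24) 1 * Eg ℤ (-504) 5 - Eg ℤ 240 3 ^ 2 := by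
    apply map_inj_ZQ
    simp only [map_mul, map_sub, map_pow, ← thetaPS_map, Eg_map, Eg2, Eg4, Eg6, ram6, map_ofNat]
    rw [PowerSeries.smul_eq_C_mul, ← mul_assoc, ← map_ofNat (PowerSeries.C (R := ℚ)) 2, ← map_mul]
    norm_num
  have h2 := congrArg (PowerSeries.map (Int.castRingHom K)) h
  simpa only [map_mul, map_sub, map_pow, ← thetaPS_map, Eg_map, map_ofNat] using h2

lemma thetaPS_eq (s : PowerSeries K) : thetaPS s = PowerSeries.X * PowerSeries.derivative K s := by
  ext n
  cases n with
  | zero => simp [thetaPS]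
  | succ n => simp [thetaPS, PowerSeries.coeff_succ_X_mul, PowerSeries.coeff_derivative, mul_comm]

lemma thetaPS_mul (s t : PowerSeries K) : thetaPS (s * t) = thetaPS s * t + s * thetaPS t := by
  simp only [thetaPS_eq, Derivation.leibniz, smul_eq_mul]; ring

lemma thetaPS_add (s t : PowerSeries K) : thetaPS (s + t) = thetaPS s + thetaPS t := by
  simp only [thetaPS_eq, map_add]; ring

lemma thetaPS_C (a : K) : thetaPS (PowerSeries.C a) = 0 := by
  simp [thetaPS_eq]

lemma C_ofNat_twelve {c : K} (hc : 12 * c = 1) :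
    (12 : PowerSeries K) * PowerSeries.C c = 1 := by
  rw [← map_ofNat (PowerSeries.C (R := K)) 12, ← map_mul, hc, map_one]

lemma Phi_D {c : K} (hc : 12 * c = 1) (f : MvPolynomial (Fin 3) K) :
    PhiK K (DK c f) = thetaPS (PhiK K f) := by
  have h12 := C_ofNat_twelve hc
  have h4 : PowerSeries.C (4 * c) = (4 : PowerSeries K) * PowerSeries.C c := by
    rw [map_mul, map_ofNat]
  have h6 : PowerSeries.C (6 * c) = (6 : PowerSeries K) * PowerSeries.C c := by
    rw [map_mul, map_ofNat]
  induction f using MvPolynomial.induction_on with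
  | C a => rw [derivation_C, map_zero, PhiK_C, thetaPS_C]
  | add f g hf hg => simp only [map_add, hf, hg, thetaPS_add]
  | mul_X f i hf =>
    rw [Derivation.leibniz, map_mul, thetaPS_mul, ← hf, map_add, smul_eq_mul, smul_eq_mul,
      map_mul, map_mul, add_comm, mul_comm (PhiK K (X i))]
    congr 2
    fin_cases i
    · change PhiK K (DK c (X 0)) = thetaPS (PhiK K (X 0))
      rw [DK_X0, PhiK_X0, map_mul, map_sub, map_pow, PhiK_C, PhiK_X0, PhiK_X1, ← ramz2]
      linear_combination thetaPS (Eg K (-24) 1) * h12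
    · change PhiK K (DK c (X 1)) = thetaPS (PhiK K (X 1))
      rw [DK_X1, PhiK_X1, map_mul, PhiK_C, h4, map_sub, map_mul, PhiK_X0, PhiK_X1, PhiK_X2, ← ramz4]
      linear_combination thetaPS (Eg K 240 3) * h12
    · change PhiK K (DK c (X 2)) = thetaPS (PhiK K (X 2))
      rw [DK_X2, PhiK_X2, map_mul, PhiK_C, h6, map_sub, map_mul, map_pow, PhiK_X0, PhiK_X1, PhiK_X2,
        ← ramz6]
      linear_combination thetaPS (Eg K (-504) 5) * h12

lemma Phi_D_iter {c : K} (hc : 12 * c = 1) (n : ℕ) (f : MvPolynomial (Fin 3) K) :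
    PhiK K ((DK c)^[n] f) = thetaPS^[n] (PhiK K f) := by
  induction n generalizing f with
  | zero => rfl
  | succ n ih => rw [Function.iterate_succ_apply, ih, Phi_D hc, Function.iterate_succ_apply]

lemma thetaPS_iter (n : ℕ) (s : PowerSeries K) :
    thetaPS^[n] s = PowerSeries.mk fun m => (m : K) ^ n * PowerSeries.coeff m s := by
  induction n generalizing s with
  | zero => ext m; simp
  | succ n ih =>
    rw [Function.iterate_succ_apply, ih]
    ext m
    simp [thetaPS, pow_succ, mul_assoc]

end QExp

section Inj

lemma poly_vanish {K : Type*} [Field K] (t : PowerSeries K) (a : K)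
    (ha : PowerSeries.constantCoeff t = a) (ht : t ≠ PowerSeries.C a) (n : ℕ)
    (g : Polynomial K) (hn : g.natDegree < n) (hg : Polynomial.aeval t g = 0) : g = 0 := by
  induction n generalizing g with
  | zero => omega
  | succ n ih =>
    by_contra hne
    have h1 : g.IsRoot a := by
      have := congrArg PowerSeries.constantCoeff hg
      rw [Polynomial.aeval_def, Polynomial.hom_eval₂, ha, map_zero] at this
      have hid : (PowerSeries.constantCoeff (R := K)).comp (algebraMap K (PowerSeries K)) =
          RingHom.id K := by ext x; simp
      rw [hid] at this
      exact this
    obtain ⟨g1, rfl⟩ := Polynomial.dvd_iff_isRoot.mpr h1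
    have hg1 : g1 ≠ 0 := by rintro rfl; simp at hne
    rw [map_mul, mul_eq_zero] at hg
    rcases hg with hg | hg
    · apply ht
      simp only [map_sub, Polynomial.aeval_X, Polynomial.aeval_C] at hg
      exact sub_eq_zero.mp hg
    · refine hg1 (ih g1 ?_ hg)
      rw [Polynomial.natDegree_mul (Polynomial.X_sub_C_ne_zero a) hg1,
        Polynomial.natDegree_X_sub_C] at hn
      omega

lemma Eg_const {K : Type*} [CommRing K] (a : ℤ) (j : ℕ) :
    PowerSeries.constantCoeff (Eg K a j) = 1 := by
  rw [← PowerSeries.coeff_zero_eq_constantCoeff_apply]; simp [Eg]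

lemma Eg_one {K : Type*} [CommRing K] (a : ℤ) (j : ℕ) :
    PowerSeries.coeff 1 (Eg K a j) = (a : K) := by
  simp [Eg, sigmaZ]

lemma coeff_one_mul' {K : Type*} [CommRing K] (s t : PowerSeries K) :
    PowerSeries.coeff 1 (s * t) = PowerSeries.constantCoeff s * PowerSeries.coeff 1 t +
      PowerSeries.coeff 1 s * PowerSeries.constantCoeff t := by
  rw [PowerSeries.coeff_mul, Finset.Nat.antidiagonal_succ]; simp

/-- A `P`-free isobaric polynomial with vanishing `q`-expansion is zero. -/
lemma Phi_inj {K : Type*} [Field K] (hK : (1728 : K) ≠ 0) (f : MvPolynomial (Fin 3) K) (w : ℕ)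
    (hw : IsWeightedHomogeneous wt f w) (hP : ∀ m, coeff m f ≠ 0 → m 0 = 0)
    (hf : PhiK K f = 0) : f = 0 := by
  by_contra hne
  obtain ⟨m₀, hm₀⟩ := ne_zero_iff.mp hne
  set e4 := Eg K 240 3 with he4
  set e6 := Eg K (-504) 5 with he6
  set V := e4⁻¹ with hV
  have hVe : e4 * V = 1 := PowerSeries.mul_inv_cancel _ (by rw [he4, Eg_const]; exact one_ne_zero)
  set t := e6 ^ 2 * V ^ 3 with ht
  have c4 : PowerSeries.constantCoeff e4 = 1 := Eg_const _ _
  have c6 : PowerSeries.constantCoeff e6 = 1 := Eg_const _ _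
  have cV : PowerSeries.constantCoeff V = 1 := by
    have := congrArg PowerSeries.constantCoeff hVe
    rw [map_mul, c4, one_mul, map_one] at this
    exact this
  have ct : PowerSeries.constantCoeff t = 1 := by simp [ht, c6, cV]
  have htne : t ≠ PowerSeries.C 1 := by
    intro h
    have h1 : e6 ^ 2 = e4 ^ 3 := by
      have : e6 ^ 2 = t * e4 ^ 3 := by
        rw [ht]; linear_combination (-(e6 ^ 2) * (1 + e4 * V + (e4 * V) ^ 2)) * hVe
      rw [this, h]; simp
    have h2 := congrArg (PowerSeries.coeff 1) h1
    simp only [pow_succ, pow_zero, one_mul, coeff_one_mul', map_mul, c4, c6] at h2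
    rw [he4, he6, Eg_one, Eg_one] at h2
    push_cast at h2
    apply hK
    linear_combination -h2
  set g : Polynomial K := ∑ m ∈ f.support, Polynomial.monomial (m 2 / 2) (coeff m f) with hg
  have hmem : ∀ m ∈ f.support, m 0 = 0 ∧ 4 * m 1 + 6 * m 2 = w := by
    intro m hm
    have h0 := hP m (mem_support_iff.mp hm)
    have := wh_weight hw (mem_support_iff.mp hm)
    exact ⟨h0, by omega⟩
  have h0 := hmem m₀ (mem_support_iff.mpr hm₀)
  have hsum : PhiK K f = e4 ^ (m₀ 1 + 3 * (m₀ 2 / 2)) * e6 ^ (m₀ 2 % 2) * Polynomial.aeval t g := by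
    rw [hg, map_sum, Finset.mul_sum]
    conv_lhs => rw [f.as_sum, map_sum]
    refine Finset.sum_congr rfl fun m hm => ?_
    obtain ⟨hm1, hm2⟩ := hmem m hm
    have e1 : m₀ 1 + 3 * (m₀ 2 / 2) = m 1 + 3 * (m 2 / 2) := by omega
    have e2 : m₀ 2 % 2 = m 2 % 2 := by omega
    rw [e1, e2, PhiK, aeval_monomial, Finsupp.prod_fintype _ _ (by simp), Fin.prod_univ_three,
      Polynomial.aeval_monomial]
    simp only [Matrix.cons_val_zero, Matrix.cons_val_one, hm1, pow_zero, one_mul]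
    change _ * (e4 ^ m 1 * e6 ^ m 2) = _
    have h3 : e6 ^ m 2 = e6 ^ (m 2 % 2) * (e6 ^ 2) ^ (m 2 / 2) := by
      rw [← pow_mul, ← pow_add, Nat.mod_add_div]
    have h4 : (e4 ^ 3) ^ (m 2 / 2) * (V ^ 3) ^ (m 2 / 2) = 1 := by
      rw [← mul_pow, ← mul_pow, hVe, one_pow, one_pow]
    rw [h3, ht, mul_pow, pow_add, pow_mul]
    linear_combination (-(algebraMap K (PowerSeries K) (coeff m f) * e4 ^ m 1 * e6 ^ (m 2 % 2) *
      (e6 ^ 2) ^ (m 2 / 2))) * h4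
  have n4 : e4 ≠ 0 := by intro h; rw [h] at c4; simp at c4
  have n6 : e6 ≠ 0 := by intro h; rw [h] at c6; simp at c6
  rw [hf] at hsum
  have hg0 : g = 0 := by
    refine poly_vanish t 1 ct htne (g.natDegree + 1) g (by omega) ?_
    rcases mul_eq_zero.mp hsum.symm with h | h
    · exact absurd h (mul_ne_zero (pow_ne_zero _ n4) (pow_ne_zero _ n6))
    · exact h
  apply hm₀
  have := congrArg (fun q => Polynomial.coeff q (m₀ 2 / 2)) hg0
  simp only [hg, Polynomial.finsetSum_coeff, Polynomial.coeff_monomial, Polynomial.coeff_zero] at this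
  rw [Finset.sum_eq_single m₀] at this
  · simpa using this
  · intro m hm hne
    rw [if_neg]
    intro heq
    apply hne
    obtain ⟨hm1, hm2⟩ := hmem m hm
    ext i
    fin_cases i
    · change m 0 = m₀ 0; omega
    · change m 1 = m₀ 1; omega
    · change m 2 = m₀ 2; omega
  · intro h; exact absurd (mem_support_iff.mpr hm₀) h

end Inj

section Local

variable {p : ℕ} [Fact p.Prime]

lemma pInt_iff (x : ℚ) : pInt p x ↔ ‖(x : ℚ_[p])‖ ≤ 1 := by
  rw [Padic.norm_rat_le_one_iff_padicValuation_le_one, Rat.padicValuation_le_one_iff]; rfl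

/-- The ring `ℤ_(p)` as a subring of `ℚ`. -/
def Zp (p : ℕ) [Fact p.Prime] : Subring ℚ :=
  (PadicInt.subring p).comap (Rat.castHom ℚ_[p])

lemma mem_Zp (x : ℚ) : x ∈ Zp p ↔ pInt p x := by
  rw [pInt_iff]; rfl

/-- Inclusion of `ℤ_(p)` into the `p`-adic integers. -/
def ZpToPadic (p : ℕ) [Fact p.Prime] : Zp p →+* ℤ_[p] where
  toFun x := ⟨((x : ℚ) : ℚ_[p]), (pInt_iff _).mp ((mem_Zp _).mp x.2)⟩
  map_one' := by apply PadicInt.ext; simp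
  map_zero' := by apply PadicInt.ext; simp
  map_add' x y := by apply PadicInt.ext; exact Rat.cast_add _ _
  map_mul' x y := by apply PadicInt.ext; exact Rat.cast_mul _ _

/-- Reduction modulo `p` on `ℤ_(p)`. -/
def redZ (p : ℕ) [Fact p.Prime] : Zp p →+* ZMod p := PadicInt.toZMod.comp (ZpToPadic p)

lemma redZ_eq_zero {x : Zp p} (h : redZ p x = 0) : ∃ y : Zp p, x = p * y := by
  have h1 : ZpToPadic p x ∈ RingHom.ker (PadicInt.toZMod (p := p)) := h
  rw [PadicInt.ker_toZMod, PadicInt.maximalIdeal_eq_span_p, Ideal.mem_span_singleton] at h1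
  obtain ⟨z, hz⟩ := h1
  have hp : (p : ℚ) ≠ 0 := by exact_mod_cast (Fact.out : p.Prime).ne_zero
  have hp' : (p : ℚ_[p]) ≠ 0 := by exact_mod_cast (Fact.out : p.Prime).ne_zero
  have hz' : ((x : ℚ) : ℚ_[p]) = p * (z : ℚ_[p]) := by
    have := congrArg (fun t : ℤ_[p] => (t : ℚ_[p])) hz
    rw [PadicInt.coe_mul, PadicInt.coe_natCast] at this
    exact this
  refine ⟨⟨(x : ℚ) / p, ?_⟩, ?_⟩
  · rw [mem_Zp, pInt_iff]
    push_cast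
    rw [hz', mul_div_cancel_left₀ _ hp']
    exact z.2
  · ext
    push_cast
    field_simp

lemma redZ_p : redZ p (p : Zp p) = 0 := by simp

lemma exists_c (hp5 : 5 ≤ p) : ∃ c : Zp p, 12 * c = 1 ∧ (c : ℚ) = 1 / 12 := by
  refine ⟨⟨1 / 12, ?_⟩, ?_, rfl⟩
  · rw [mem_Zp]
    have : ((1 : ℚ) / 12).den = 12 := by norm_num
    rw [pInt, this]
    intro h
    have hp : p.Prime := Fact.out
    have h2 : p ∣ 2 * 2 * 3 := by simpa using h
    rw [hp.dvd_mul, hp.dvd_mul] at h2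
    rcases h2 with (h2 | h2) | h2 <;> have := Nat.le_of_dvd (by norm_num) h2 <;> omega
  · ext
    change ((12 : ℕ) : ℚ) * (1 / 12) = 1
    norm_num

lemma exists_lift {f : Poly3} (h : polyPInt p f) :
    ∃ F : MvPolynomial (Fin 3) (Zp p), map (Zp p).subtype F = f := by
  have : f ∈ (map (Zp p).subtype : MvPolynomial (Fin 3) (Zp p) →+* Poly3).range := by
    change f ∈ Set.range (map (Zp p).subtype : MvPolynomial (Fin 3) (Zp p) →+* Poly3)
    rw [mem_range_map_iff_coeffs_subset]
    intro x hx
    obtain ⟨m, _, rfl⟩ := mem_coeffs_iff.mp hx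
    exact ⟨⟨coeff m f, (mem_Zp _).mpr (h m)⟩, rfl⟩
  exact this

lemma polyPInt_map (F : MvPolynomial (Fin 3) (Zp p)) : polyPInt p (map (Zp p).subtype F) := by
  intro m
  rw [coeff_map, ← mem_Zp]
  exact (coeff m F).2

lemma red_poly_zero {F : MvPolynomial (Fin 3) (Zp p)} (h : map (redZ p) F = 0) :
    ∃ G : MvPolynomial (Fin 3) (Zp p), F = C (p : Zp p) * G := by
  have : C (p : Zp p) ∣ F := by
    rw [C_dvd_iff_dvd_coeff]
    intro m
    obtain ⟨y, hy⟩ := redZ_eq_zero (p := p) (x := coeff m F) (by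
      rw [← coeff_map, h, coeff_zero])
    exact ⟨y, hy⟩
  exact this

lemma redZ_surj : Function.Surjective (redZ p) := by
  intro x
  obtain ⟨n, rfl⟩ := ZMod.natCast_zmod_surjective x
  exact ⟨n, by simp⟩

lemma bern_norm (hp5 : 5 ≤ p) : ‖((bernoulli (p - 1) : ℚ) : ℚ_[p])‖ = p := by
  have hp : p.Prime := Fact.out
  obtain ⟨k, hk⟩ : ∃ k, p - 1 = 2 * k := by
    rcases hp.eq_two_or_odd' with h | ⟨k, h⟩
    · omega
    · exact ⟨k, by omega⟩
  obtain ⟨n, hn⟩ := Bernoulli.vonStaudt_clausen k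
  rw [← hk] at hn
  have hr : p - 1 + 2 = p + 1 := by omega
  rw [hr] at hn
  have hmem : p ∈ Finset.filter (fun q => Nat.Prime q ∧ q - 1 ∣ p - 1) (Finset.range (p + 1)) := by
    simp [hp]
  rw [← Finset.add_sum_erase _ _ hmem] at hn
  set S : ℚ := ∑ q ∈ (Finset.filter (fun q => Nat.Prime q ∧ q - 1 ∣ p - 1)
    (Finset.range (p + 1))).erase p, 1 / (q : ℚ) with hS
  have hSm : S ∈ Zp p := by
    refine Subring.sum_mem _ fun q hq => ?_
    rw [mem_Zp, pInt]
    simp only [Finset.mem_erase, Finset.mem_filter] at hq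
    have hd : ((1 : ℚ) / q).den = q := by
      rw [one_div, Rat.inv_natCast_den_of_pos hq.2.2.1.pos]
    rw [hd, Nat.prime_dvd_prime_iff_eq hp hq.2.2.1]
    exact fun h => hq.1 h.symm
  have hx : (n : ℚ) - S ∈ Zp p := Subring.sub_mem _ (intCast_mem _ n) hSm
  rw [mem_Zp, pInt_iff] at hx
  have hB : bernoulli (p - 1) = ((n : ℚ) - S) + (-1 / p) := by linear_combination hn.symm
  have hnorm : ‖((-1 / p : ℚ) : ℚ_[p])‖ = p := by
    push_cast
    rw [norm_div, norm_neg, norm_one, Padic.norm_p]; simp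
  have hp1 : (1 : ℝ) < p := by exact_mod_cast hp.one_lt
  rw [hB, Rat.cast_add, Padic.add_eq_max_of_ne, hnorm, max_eq_right (by linarith)]
  rw [hnorm]; exact ne_of_lt (by linarith)

/-- The Hasse invariant is congruent to one. -/
lemma EAs_coeff (hp5 : 5 ≤ p) (n : ℕ) (hn : n ≠ 0) :
    ∃ y : Zp p, PowerSeries.coeff n (EAs p) = p * (y : ℚ) := by
  have hp : p.Prime := Fact.out
  have hp0 : (p : ℚ) ≠ 0 := by exact_mod_cast hp.ne_zero
  have hs : sigmaQ (p - 2) n ∈ Zp p :=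
    Subring.sum_mem _ fun d _ => Subring.pow_mem _ (natCast_mem _ d) _
  have hz : -(2 * ((p : ℚ) - 1)) ∈ Zp p := by
    have : -(2 * ((p : ℚ) - 1)) = ((-(2 * ((p : ℤ) - 1)) : ℤ) : ℚ) := by push_cast; ring
    rw [this]; exact intCast_mem _ _
  have hB : 1 / (p * bernoulli (p - 1)) ∈ Zp p := by
    rw [mem_Zp, pInt_iff]
    push_cast
    rw [norm_div, norm_mul, Padic.norm_p, bern_norm hp5, norm_one, inv_mul_cancel₀]
    · simp
    · exact_mod_cast hp.ne_zero
  refine ⟨⟨_, Subring.mul_mem _ (Subring.mul_mem _ hz hB) hs⟩, ?_⟩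
  simp only [EAs, PowerSeries.coeff_mk, if_neg hn]
  have hb0 : bernoulli (p - 1) ≠ 0 := by
    intro h
    have := bern_norm hp5
    rw [h] at this
    simp at this
    exact hp.ne_zero (by exact_mod_cast this.symm)
  field_simp

end Local

section Leibniz

lemma leibniz_iter {K R : Type*} [CommRing K] [CommRing R] [Algebra K R] (d : Derivation K R R)
    (n : ℕ) (f g : R) : d^[n] (f * g) =
      ∑ x ∈ Finset.HasAntidiagonal.antidiagonal n, n.choose x.1 • (d^[x.1] f * d^[x.2] g) := by
  induction n with
  | zero => simp
  | succ n ih =>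
    rw [Finset.sum_antidiagonal_choose_succ_nsmul (fun i j => d^[i] f * d^[j] g),
      Function.iterate_succ_apply', ih, map_sum, ← Finset.sum_add_distrib]
    refine Finset.sum_congr rfl fun x hx => ?_
    rw [map_nsmul, Derivation.leibniz,
      ← Nat.choose_symm_of_eq_add (Finset.HasAntidiagonal.mem_antidiagonal.mp hx).symm, ← smul_add]
    simp only [Function.iterate_succ_apply', smul_eq_mul]
    ring

/-- In characteristic `p` the `p`-th power of a derivation is a derivation. -/
lemma leibniz_p {K R : Type*} [CommRing K] [CommRing R] [Algebra K R] (d : Derivation K R R)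
    (p : ℕ) (hp : p.Prime) [CharP R p] (f g : R) :
    d^[p] (f * g) = f * d^[p] g + g * d^[p] f := by
  rw [leibniz_iter, Finset.Nat.sum_antidiagonal_eq_sum_range_succ
    (fun i j => p.choose i • (d^[i] f * d^[j] g)), Finset.sum_range_succ]
  obtain ⟨q, rfl⟩ : ∃ q, p = q + 1 := ⟨p - 1, by have := hp.pos; omega⟩
  rw [Finset.sum_range_succ', Finset.sum_eq_zero]
  · simp; ring
  · intro i hi
    rw [Finset.mem_range] at hi
    have h1 : q + 1 ∣ (q + 1).choose (i + 1) := hp.dvd_choose_self (by omega) (by omega)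
    rw [nsmul_eq_mul, (CharP.cast_eq_zero_iff R (q + 1) _).mpr h1, zero_mul]

end Leibniz

section ModP

variable {K : Type*} [CommRing K]

lemma iter_C (d : Derivation K (MvPolynomial (Fin 3) K) (MvPolynomial (Fin 3) K)) {n : ℕ}
    (hn : n ≠ 0) (x : K) : d^[n] (C x) = 0 := by
  obtain ⟨q, rfl⟩ : ∃ q, n = q + 1 := ⟨n - 1, by omega⟩
  rw [Function.iterate_succ_apply, derivation_C, iter_zero]

/-- `P`-free polynomials. -/
def PF (f : MvPolynomial (Fin 3) K) : Prop := f ∈ supported K ({0}ᶜ : Set (Fin 3))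

lemma PF_iff (f : MvPolynomial (Fin 3) K) : PF f ↔ ∀ m, coeff m f ≠ 0 → m 0 = 0 := by
  rw [PF, mem_supported]
  constructor
  · intro h m hm
    by_contra h0
    have : (0 : Fin 3) ∈ f.vars := by
      rw [mem_vars_iff_mem_support]; exact ⟨m, mem_support_iff.mpr hm, by simpa using h0⟩
    have := h this
    simp at this
  · intro h i hi
    rw [Finset.mem_coe, mem_vars_iff_mem_support] at hi
    obtain ⟨m, hm, hi⟩ := hi
    rintro rfl
    simp [h m (mem_support_iff.mp hm)] at hi

lemma PF.pderiv {f : MvPolynomial (Fin 3) K} (h : PF f) : pderiv 0 f = 0 := by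
  apply pderiv_eq_zero_of_notMem_vars
  intro h0
  have := (mem_supported.mp h) h0
  simp at this

lemma PF.mul {f g : MvPolynomial (Fin 3) K} (hf : PF f) (hg : PF g) : PF (f * g) :=
  Subalgebra.mul_mem _ hf hg

lemma PF.sub {f g : MvPolynomial (Fin 3) K} (hf : PF f) (hg : PF g) : PF (f - g) :=
  Subalgebra.sub_mem _ hf hg

lemma PF_C (a : K) : PF (C a) := Subalgebra.algebraMap_mem _ a

lemma PF_X {i : Fin 3} (h : i ≠ 0) : PF (X i : MvPolynomial (Fin 3) K) :=
  Algebra.subset_adjoin ⟨i, by simpa using h, rfl⟩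

variable {p : ℕ} [Fact p.Prime]

lemma PF_of_small {f : MvPolynomial (Fin 3) (ZMod p)} {n : ℕ} (h : pderiv 0 f = 0)
    (hw : IsWeightedHomogeneous wt f n) (hn : n < 2 * p) : PF f := by
  rw [PF_iff]
  intro m hm
  have h1 := dvd_of_pderiv_zero h hm
  have h2 := wh_weight hw hm
  by_contra h0
  have := Nat.le_of_dvd (Nat.pos_of_ne_zero h0) h1
  omega

lemma ne1728 (hp5 : 5 ≤ p) : (1728 : ZMod p) ≠ 0 := by
  have hp : p.Prime := Fact.out
  intro h
  have h1 : ((1728 : ℕ) : ZMod p) = 0 := by exact_mod_cast h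
  rw [ZMod.natCast_eq_zero_iff] at h1
  have h2 : p ∣ 2 ^ 6 * 3 ^ 3 := by simpa using h1
  rw [hp.dvd_mul] at h2
  rcases h2 with h2 | h2 <;> have := Nat.le_of_dvd (by norm_num) (hp.dvd_of_dvd_pow h2) <;> omega

lemma coeff_Dp (c : Zp p) {i : Fin 3} (hi : i ≠ 0) :
    coeff (Finsupp.single i 1 + Finsupp.single 0 p) ((DK (redZ p c))^[p] (X i)) = 0 := by
  have hp : p.Prime := Fact.out
  have e : (DK (redZ p c))^[p] (X i) = map (redZ p) ((DK c)^[p] (X i)) := by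
    rw [DK_iter_map, map_X]
  rw [e, coeff_map]
  have h1 := pderiv_iter_D_iter c p p (wt i) le_rfl (X i) (PF_X hi).pderiv (HK_of_wh (wh_X i))
  have h2 := congrArg (coeff (Finsupp.single i 1)) h1
  rw [coeff_pderiv_iter, coeff_C_mul, Nat.sub_self, Function.iterate_zero, id] at h2
  have h3 : coeff (Finsupp.single i 1) (X i : MvPolynomial (Fin 3) (Zp p)) = 1 := coeff_X_same i
  have h4 : (Finsupp.single i 1 : Fin 3 →₀ ℕ) 0 = 0 := by simp [hi.symm]
  rw [h3, h4, zero_add, mul_one] at h2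
  obtain ⟨u, hu⟩ : p ∣ (wt i + p - 1).descFactorial p :=
    (Nat.dvd_factorial hp.pos le_rfl).trans (Nat.factorial_dvd_descFactorial _ _)
  have h5 : coeff (Finsupp.single i 1 + Finsupp.single 0 p) ((DK c)^[p] (X i)) =
      (p : Zp p) * (u * c ^ p) := by
    have hne : ((p.descFactorial p : ℕ) : Zp p) ≠ 0 := by
      intro h
      have := congrArg (fun x : Zp p => (x : ℚ)) h
      simp at this
    apply mul_left_cancel₀ hne
    rw [h2, hu]; push_cast; ring
  rw [h5, map_mul, redZ_p, zero_mul]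

lemma thetaPS_p (s : PowerSeries (ZMod p)) : thetaPS^[p] s = thetaPS s := by
  rw [thetaPS_iter]; ext m; simp [thetaPS, ZMod.pow_card]

lemma pderiv_Dp (c : ZMod p) (f : MvPolynomial (Fin 3) (ZMod p)) :
    pderiv 0 ((DK c)^[p] f) = (DK c)^[p] (pderiv 0 f) := by
  obtain ⟨q, hq⟩ : ∃ q, p = q + 1 := ⟨p - 1, by have := (Fact.out : p.Prime).pos; omega⟩
  have h := pderiv_D_iter c q f
  rw [← hq] at h
  rw [h]; simp

lemma twelve_red {c : Zp p} (hc : 12 * c = 1) : 12 * redZ p c = 1 := by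
  have := congrArg (redZ p) hc
  rw [map_mul, map_ofNat, map_one] at this
  exact this

/-- The second derivative of the Hasse invariant vanishes modulo `p`. -/
lemma DD_zero (hp5 : 5 ≤ p) {c : ZMod p} (hc : 12 * c = 1)
    {a : MvPolynomial (Fin 3) (ZMod p)} (hw : IsWeightedHomogeneous wt a (p - 1)) (hP : PF a)
    (hΦ : PhiK (ZMod p) a = 1) : DK c (DK c a) = 0 := by
  have hp : p.Prime := Fact.out
  have h1 := pderiv_D_iter_of c 1 (p - 1) a hP.pderiv (HK_of_wh hw)
  have h2 : (1 + 1) * (p - 1 + 1) = 2 * p := by omega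
  rw [h2] at h1
  have h3 : pderiv 0 (DK c (DK c a)) = 0 := by
    have e : (DK c)^[1 + 1] a = DK c (DK c a) := rfl
    rw [← e, h1]; simp
  have hwt := wh_D c (wh_D c hw)
  refine Phi_inj (ne1728 hp5) _ _ hwt ((PF_iff _).mp (PF_of_small h3 hwt (by omega))) ?_
  rw [Phi_D hc, Phi_D hc, hΦ]
  have h4 : thetaPS (1 : PowerSeries (ZMod p)) = 0 := by
    rw [← map_one (PowerSeries.C (R := ZMod p)), thetaPS_C]
  have h5 : thetaPS (0 : PowerSeries (ZMod p)) = 0 := by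
    have := thetaPS_C (0 : ZMod p)
    rwa [map_zero] at this
  rw [h4, h5]

lemma B_exists (hp5 : 5 ≤ p) {c : ZMod p} (hc : 12 * c = 1)
    {a : MvPolynomial (Fin 3) (ZMod p)} (hw : IsWeightedHomogeneous wt a (p - 1)) (hP : PF a)
    (hΦ : PhiK (ZMod p) a = 1) : ∃ b : MvPolynomial (Fin 3) (ZMod p), IsWeightedHomogeneous wt b (p + 1) ∧ PF b ∧
    PhiK (ZMod p) b = Eg (ZMod p) (-24) 1 := by
  have hp : p.Prime := Fact.out
  have e : p - 1 + 2 = p + 1 := by omega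
  have hwt : IsWeightedHomogeneous wt (C 12 * DK c a + X 0 * a) (p + 1) := by
    refine IsWeightedHomogeneous.add (wh_C_mul _ (e ▸ wh_D c hw)) ?_
    have h1 : wt 0 + (p - 1) = p + 1 := by rw [← e]; simp [wt, add_comm]
    exact h1 ▸ (wh_X 0).mul hw
  refine ⟨C 12 * DK c a + X 0 * a, hwt, PF_of_small ?_ hwt (by omega), ?_⟩
  · have h1 := comm_pD c a
    rw [hP.pderiv, map_zero, HK_of_wh hw, zero_add, Nat.cast_sub hp.one_le] at h1
    rw [map_add, pderiv_C_mul, h1, pderiv_mul, hP.pderiv, pderiv_X_self, mul_zero, add_zero,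
      one_mul, ← mul_assoc, ← mul_assoc, ← C_mul, ← C_mul, hc]
    simp
  · have h4 : thetaPS (1 : PowerSeries (ZMod p)) = 0 := by
      rw [← map_one (PowerSeries.C (R := ZMod p)), thetaPS_C]
    rw [map_add, map_mul, map_mul, Phi_D hc, hΦ, h4, PhiK_X0]; simp

lemma Dp_gen (hp5 : 5 ≤ p) {c : ZMod p} (hc : 12 * c = 1)
    {a : MvPolynomial (Fin 3) (ZMod p)} (hw : IsWeightedHomogeneous wt a (p - 1)) (hP : PF a)
    (hΦ : PhiK (ZMod p) a = 1) (c' : Zp p) (hc' : redZ p c' = c) {i : Fin 3} (hi : i ≠ 0)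
    (r : MvPolynomial (Fin 3) (ZMod p)) (hr : IsWeightedHomogeneous wt r (wt i + 2 * p))
    (hrP : PF r) (hrΦ : PhiK (ZMod p) r = thetaPS (PhiK (ZMod p) (X i))) :
    (DK c)^[p] (X i) = r := by
  have hp : p.Prime := Fact.out
  rw [← sub_eq_zero]
  have hwt := wh_sub (wh_D_iter c (wh_X i) p) hr
  refine Phi_inj (ne1728 hp5) _ _ hwt ?_ ?_
  · intro m hm
    by_contra h0
    have hd : pderiv 0 ((DK c)^[p] (X i) - r) = 0 := by
      rw [map_sub, hrP.pderiv, pderiv_Dp, (PF_X hi).pderiv, iter_zero, sub_zero]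
    obtain ⟨u, hu⟩ := dvd_of_pderiv_zero hd hm
    have hmw := wh_weight hwt hm
    have hr0 : coeff m r = 0 := by
      by_contra h
      exact h0 ((PF_iff _).mp hrP m h)
    have hu1 : u = 1 := by
      have : wt i ≤ 6 := by fin_cases i <;> simp [wt]
      have hu0 : u ≠ 0 := by rintro rfl; simp at hu; exact h0 hu
      by_contra hu1
      have : 2 ≤ u := by omega
      have : p * 2 ≤ p * u := Nat.mul_le_mul_left _ this
      omega
    rw [hu1, mul_one] at hu
    have hm' : m = Finsupp.single i 1 + Finsupp.single 0 p := by
      ext j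
      fin_cases i
      · exact absurd rfl hi
      · simp [wt] at hmw
        have h1 : m 1 = 1 ∧ m 2 = 0 := by omega
        fin_cases j <;> simp [hu, h1]
      · simp [wt] at hmw
        have h1 : m 1 = 0 ∧ m 2 = 1 := by omega
        fin_cases j <;> simp [hu, h1]
    apply hm
    rw [coeff_sub, hr0, hm', ← hc', coeff_Dp c' hi, sub_zero]
  · rw [map_sub, hrΦ, Phi_D_iter hc, thetaPS_p, sub_self]

lemma Dp_X1 (hp5 : 5 ≤ p) {c : ZMod p} (hc : 12 * c = 1)
    {a : MvPolynomial (Fin 3) (ZMod p)} (hw : IsWeightedHomogeneous wt a (p - 1)) (hP : PF a)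
    (hΦ : PhiK (ZMod p) a = 1) (c' : Zp p) (hc' : redZ p c' = c) : ∃ w, (DK c)^[p] (X 1) = a * w := by
  have hp : p.Prime := Fact.out
  obtain ⟨b, hbw, hbP, hbΦ⟩ := B_exists hp5 hc hw hP hΦ
  refine ⟨C (4 * c) * (b * X 1 - a * X 2), ?_⟩
  apply Dp_gen hp5 hc hw hP hΦ c' hc' (by decide)
  · have h1 : IsWeightedHomogeneous wt (b * X 1 - a * X 2) (p + 5) :=
      wh_sub (hbw.mul (wh_X 1)) (by
        have : p - 1 + wt 2 = p + 5 := by simp [wt]; omega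
        exact this ▸ hw.mul (wh_X 2))
    have h2 : p - 1 + (p + 5) = wt 1 + 2 * p := by simp [wt]; omega
    exact h2 ▸ hw.mul (wh_C_mul _ h1)
  · exact hP.mul ((PF_C _).mul ((hbP.mul (PF_X (by decide))).sub (hP.mul (PF_X (by decide)))))
  · have h12 := C_ofNat_twelve hc
    have h4 : PowerSeries.C (4 * c) = (4 : PowerSeries (ZMod p)) * PowerSeries.C c := by
      rw [map_mul, map_ofNat]
    rw [map_mul, hΦ, one_mul, map_mul, PhiK_C, h4, map_sub, map_mul, map_mul, hbΦ, hΦ, one_mul,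
      PhiK_X1, PhiK_X2, ← ramz4]
    linear_combination thetaPS (Eg (ZMod p) 240 3) * h12

lemma Dp_X2 (hp5 : 5 ≤ p) {c : ZMod p} (hc : 12 * c = 1)
    {a : MvPolynomial (Fin 3) (ZMod p)} (hw : IsWeightedHomogeneous wt a (p - 1)) (hP : PF a)
    (hΦ : PhiK (ZMod p) a = 1) (c' : Zp p) (hc' : redZ p c' = c) : ∃ w, (DK c)^[p] (X 2) = a * w := by
  have hp : p.Prime := Fact.out
  obtain ⟨b, hbw, hbP, hbΦ⟩ := B_exists hp5 hc hw hP hΦ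
  refine ⟨C (6 * c) * (b * X 2 - a * (X 1 * X 1)), ?_⟩
  apply Dp_gen hp5 hc hw hP hΦ c' hc' (by decide)
  · have h1 : IsWeightedHomogeneous wt (b * X 2 - a * (X 1 * X 1)) (p + 7) :=
      wh_sub (hbw.mul (wh_X 2)) (by
        have : p - 1 + (wt 1 + wt 1) = p + 7 := by simp [wt]; omega
        exact this ▸ hw.mul ((wh_X 1).mul (wh_X 1)))
    have h2 : p - 1 + (p + 7) = wt 2 + 2 * p := by simp [wt]; omega
    exact h2 ▸ hw.mul (wh_C_mul _ h1)
  · exact hP.mul ((PF_C _).mul ((hbP.mul (PF_X (by decide))).sub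
      (hP.mul ((PF_X (by decide)).mul (PF_X (by decide))))))
  · have h12 := C_ofNat_twelve hc
    have h6 : PowerSeries.C (6 * c) = (6 : PowerSeries (ZMod p)) * PowerSeries.C c := by
      rw [map_mul, map_ofNat]
    rw [map_mul, hΦ, one_mul, map_mul, PhiK_C, h6, map_sub, map_mul, map_mul, hbΦ, hΦ, one_mul,
      map_mul, PhiK_X1, PhiK_X2, ← pow_two, ← ramz6]
    linear_combination thetaPS (Eg (ZMod p) (-504) 5) * h12

lemma Dp_apply (hp5 : 5 ≤ p) {c : ZMod p} (hc : 12 * c = 1)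
    {a : MvPolynomial (Fin 3) (ZMod p)} (hw : IsWeightedHomogeneous wt a (p - 1)) (hP : PF a)
    (hΦ : PhiK (ZMod p) a = 1) (c' : Zp p) (hc' : redZ p c' = c) (f : MvPolynomial (Fin 3) (ZMod p)) :
    ∃ w, (DK c)^[p] f = (DK c)^[p] (X 0) * pderiv 0 f + a * w := by
  have hp : p.Prime := Fact.out
  obtain ⟨w1, h1⟩ := Dp_X1 hp5 hc hw hP hΦ c' hc'
  obtain ⟨w2, h2⟩ := Dp_X2 hp5 hc hw hP hΦ c' hc'
  induction f using MvPolynomial.induction_on with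
  | C x =>
    refine ⟨0, ?_⟩
    have : (DK c)^[p] (C x) = 0 := iter_C _ hp.ne_zero _
    rw [this]; simp
  | add f g hf hg =>
    obtain ⟨u, hu⟩ := hf
    obtain ⟨v, hv⟩ := hg
    refine ⟨u + v, ?_⟩
    rw [iter_add, hu, hv, map_add]; ring
  | mul_X f i hf =>
    obtain ⟨u, hu⟩ := hf
    rw [leibniz_p (DK c) p hp, hu, pderiv_mul]
    fin_cases i
    · refine ⟨X 0 * u, ?_⟩
      simp; ring
    · refine ⟨X 1 * u + f * w1, ?_⟩
      simp [h1, pderiv_X]; ring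
    · refine ⟨X 2 * u + f * w2, ?_⟩
      simp [h2, pderiv_X]; ring

lemma Dp_iter (hp5 : 5 ≤ p) {c : ZMod p} (hc : 12 * c = 1)
    {a : MvPolynomial (Fin 3) (ZMod p)} (hw : IsWeightedHomogeneous wt a (p - 1)) (hP : PF a)
    (hΦ : PhiK (ZMod p) a = 1) (c' : Zp p) (hc' : redZ p c' = c) (j : ℕ) (f : MvPolynomial (Fin 3) (ZMod p)) :
    ∃ w, (DK c)^[p * j] f = ((DK c)^[p] (X 0)) ^ j * (pderiv 0)^[j] f + a * w := by
  have hp : p.Prime := Fact.out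
  have hβ : pderiv 0 ((DK c)^[p] (X 0)) = 0 := by
    rw [pderiv_Dp, pderiv_X_self, ← C_1, iter_C _ hp.ne_zero]
  induction j with
  | zero => exact ⟨0, by simp⟩
  | succ j ih =>
    obtain ⟨w, h⟩ := ih
    rw [Nat.mul_succ, Nat.add_comm, Function.iterate_add_apply, h, iter_add, leibniz_p (DK c) p hp a w]
    obtain ⟨u, hu⟩ := Dp_apply hp5 hc hw hP hΦ c' hc' (((DK c)^[p] (X 0)) ^ j * (pderiv 0)^[j] f)
    obtain ⟨v, hv⟩ := Dp_apply hp5 hc hw hP hΦ c' hc' a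
    rw [hu, hv, hP.pderiv, pderiv_mul, pderiv_pow, hβ, Function.iterate_succ_apply']
    exact ⟨u + (DK c)^[p] w + w * v, by ring⟩

end ModP

section Hurwitz

variable {K : Type*} [CommRing K] [Algebra ℚ K]

/-- The inverse factorial. -/
def ef (K : Type*) [CommRing K] [Algebra ℚ K] (n : ℕ) : K := algebraMap ℚ K ((n.factorial : ℚ)⁻¹)

lemma fac_ef (n : ℕ) : (n.factorial : K) * ef K n = 1 := by
  rw [ef, ← map_natCast (algebraMap ℚ K), ← map_mul, mul_inv_cancel₀, map_one]
  exact_mod_cast n.factorial_ne_zero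

lemma ef_choose (i j : ℕ) : ef K (i + j) * ((i + j).choose i : K) = ef K i * ef K j := by
  have h1 := fac_ef (K := K) i
  have h2 := fac_ef (K := K) j
  have h3 := fac_ef (K := K) (i + j)
  have h4 : ((i + j).choose i : K) * i.factorial * j.factorial = (i + j).factorial := by
    rw [Nat.choose_symm_add]
    simpa only [Nat.cast_mul] using
      congrArg (Nat.cast : ℕ → K) (Nat.add_choose_mul_factorial_mul_factorial i j)
  calc ef K (i + j) * ((i + j).choose i : K)
      = ef K (i + j) * ((i + j).choose i : K) * ((i.factorial : K) * ef K i)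
          * ((j.factorial : K) * ef K j) := by rw [h1, h2]; ring
    _ = ((((i + j).choose i : K) * i.factorial * j.factorial) * ef K (i + j))
          * (ef K i * ef K j) := by ring
    _ = _ := by rw [h4, h3, one_mul]

/-- The Taylor expansion map. -/
def Tay (d : Derivation ℚ K K) (f : K) : PowerSeries K := PowerSeries.mk fun n => ef K n * d^[n] f

lemma Tay_mul (d : Derivation ℚ K K) (f g : K) : Tay d (f * g) = Tay d f * Tay d g := by
  ext n
  rw [PowerSeries.coeff_mul, Tay, PowerSeries.coeff_mk, leibniz_iter, Finset.mul_sum]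
  refine Finset.sum_congr rfl fun x hx => ?_
  rw [Tay, Tay, PowerSeries.coeff_mk, PowerSeries.coeff_mk, nsmul_eq_mul]
  have := ef_choose (K := K) x.1 x.2
  rw [Finset.HasAntidiagonal.mem_antidiagonal.mp hx] at this
  linear_combination d^[x.1] f * d^[x.2] g * this

lemma Tay_pow (d : Derivation ℚ K K) (f : K) (m : ℕ) : Tay d (f ^ (m + 1)) = Tay d f ^ (m + 1) := by
  induction m with
  | zero => simp
  | succ m ih => rw [pow_succ, Tay_mul, ih, pow_succ _ (m + 1)]

/-- Hurwitz-integral series. -/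
def Hz (O : Subring K) : Subring (PowerSeries K) where
  carrier := {s | ∀ n, (n.factorial : K) * PowerSeries.coeff n s ∈ O}
  mul_mem' := by
    intro s t hs ht n
    rw [PowerSeries.coeff_mul, Finset.mul_sum]
    refine Subring.sum_mem _ fun x hx => ?_
    have h4 : (n.choose x.1 : K) * x.1.factorial * x.2.factorial = n.factorial := by
      rw [← Finset.HasAntidiagonal.mem_antidiagonal.mp hx, Nat.choose_symm_add]
      simpa only [Nat.cast_mul] using
      congrArg (Nat.cast : ℕ → K) (Nat.add_choose_mul_factorial_mul_factorial x.1 x.2)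
    have : (n.factorial : K) * (PowerSeries.coeff x.1 s * PowerSeries.coeff x.2 t) =
        (n.choose x.1 : K) * (((x.1.factorial : K) * PowerSeries.coeff x.1 s) *
          ((x.2.factorial : K) * PowerSeries.coeff x.2 t)) := by rw [← h4]; ring
    rw [this]
    exact O.mul_mem (natCast_mem _ _) (O.mul_mem (hs _) (ht _))
  one_mem' := by
    intro n
    rw [PowerSeries.coeff_one]
    split_ifs <;> simp
  add_mem' := by
    intro s t hs ht n
    rw [map_add, mul_add]
    exact O.add_mem (hs n) (ht n)
  zero_mem' := by intro n; simp
  neg_mem' := by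
    intro s hs n
    rw [map_neg, mul_neg]
    exact O.neg_mem (hs n)

lemma expand_p {S : Type*} [CommRing S] {p : ℕ} (hp : p.Prime) (hp3 : 3 ≤ p) (x y : S) :
    ∃ w, (p * y + x) ^ p = x ^ p + p ^ 2 * (x ^ (p - 1) * y) + p ^ 3 * w := by
  obtain ⟨q, rfl⟩ : ∃ q, p = q + 1 := ⟨p - 1, by omega⟩
  rw [add_pow, Finset.sum_range_succ', Finset.sum_range_succ']
  have : ((q + 1 : ℕ) : S) ^ 3 ∣ ∑ k ∈ Finset.range q, (((q + 1 : ℕ) : S) * y) ^ (k + 1 + 1) *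
      x ^ (q + 1 - (k + 1 + 1)) * ((q + 1).choose (k + 1 + 1) : S) := by
    refine Finset.dvd_sum fun k hk => ?_
    rw [Finset.mem_range] at hk
    by_cases hk1 : k + 1 = q
    · rw [mul_pow, mul_assoc, mul_assoc]
      exact Dvd.dvd.mul_right (pow_dvd_pow _ (by omega)) _
    · obtain ⟨u, hu⟩ : q + 1 ∣ (q + 1).choose (k + 1 + 1) :=
        hp.dvd_choose_self (by omega) (by omega)
      refine ⟨y ^ (k + 2) * x ^ (q + 1 - (k + 1 + 1)) * u * ((q + 1 : ℕ) : S) ^ k, ?_⟩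
      rw [hu, Nat.cast_mul]
      ring
  obtain ⟨w, hw⟩ := this
  refine ⟨w, ?_⟩
  rw [hw]
  simp
  ring

lemma lin_coeff {O : Subring K} {a b : K} (ha : a ∈ O) (hb : b ∈ O) (m : ℕ) :
    (∀ n, PowerSeries.coeff n ((PowerSeries.C a + PowerSeries.C b * PowerSeries.X) ^ m) ∈ O) ∧
    (∀ n, m < n → PowerSeries.coeff n ((PowerSeries.C a + PowerSeries.C b * PowerSeries.X) ^ m) = 0) ∧
    PowerSeries.coeff 0 ((PowerSeries.C a + PowerSeries.C b * PowerSeries.X) ^ m) = a ^ m := by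
  refine ⟨?_, ?_, by simp⟩
  · induction m with
    | zero => intro n; rw [pow_zero, PowerSeries.coeff_one]; split_ifs <;> simp
    | succ m ih =>
      intro n
      rw [pow_succ, mul_add, ← mul_assoc, map_add, PowerSeries.coeff_mul_C]
      refine O.add_mem (O.mul_mem (ih n) ha) ?_
      cases n with
      | zero => simp
      | succ n =>
        rw [PowerSeries.coeff_succ_mul_X, PowerSeries.coeff_mul_C]
        exact O.mul_mem (ih n) hb
  · induction m with
    | zero => intro n hn; rw [pow_zero, PowerSeries.coeff_one, if_neg (by omega)]
    | succ m ih =>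
      intro n hn
      rw [pow_succ, mul_add, ← mul_assoc, map_add, PowerSeries.coeff_mul_C, ih n (by omega)]
      cases n with
      | zero => simp
      | succ n =>
        rw [PowerSeries.coeff_succ_mul_X, PowerSeries.coeff_mul_C, ih n (by omega)]
        simp

lemma key_expand (d : Derivation ℚ K K) (O : Subring K) {p : ℕ} (hp : p.Prime) (hp3 : 3 ≤ p)
    (a : K) (ha : a ∈ O) (hb : d a ∈ O) (y : ℕ → K) (hy : ∀ n, y n ∈ O)
    (hd : ∀ n, 2 ≤ n → d^[n] a = p * y n) :
    ∃ g ∈ O, d^[p ^ 2] (a ^ p) = p * a ^ (p - 1) * d^[p ^ 2] a + p ^ 3 * g := by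
  set L : PowerSeries K := PowerSeries.C a + PowerSeries.C (d a) * PowerSeries.X with hL
  set Y : PowerSeries K := PowerSeries.mk fun n => if 2 ≤ n then ef K n * y n else 0 with hY
  have hp2 : p < p ^ 2 := by nlinarith
  have hT : Tay d a = (p : PowerSeries K) * Y + L := by
    ext n
    have hpC : (p : PowerSeries K) = PowerSeries.C (p : K) := by simp
    rw [hpC, map_add, PowerSeries.coeff_C_mul, hY, hL, Tay, PowerSeries.coeff_mk,
      PowerSeries.coeff_mk, map_add, PowerSeries.coeff_C_mul, PowerSeries.coeff_X,
      PowerSeries.coeff_C]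
    rcases n with _ | _ | n
    · have := fac_ef (K := K) 0
      simp at this
      simp [this]
    · have := fac_ef (K := K) 1
      simp at this
      simp [this]
    · rw [hd _ (by omega)]
      simp
      ring
  have hYH : Y ∈ Hz O := by
    intro n
    rw [hY, PowerSeries.coeff_mk]
    split_ifs
    · rw [← mul_assoc, fac_ef, one_mul]; exact hy n
    · simp
  have hLH : L ∈ Hz O := by
    intro n
    have := (lin_coeff ha hb 1).1 n
    rw [pow_one] at this
    exact O.mul_mem (natCast_mem _ _) this
  obtain ⟨⟨W, hW⟩, hw⟩ := expand_p hp hp3 (⟨L, hLH⟩ : Hz O) ⟨Y, hYH⟩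
  have hw' : ((p : PowerSeries K) * Y + L) ^ p =
      L ^ p + (p : PowerSeries K) ^ 2 * (L ^ (p - 1) * Y) + (p : PowerSeries K) ^ 3 * W := by
    have := congrArg (fun s : Hz O => (s : PowerSeries K)) hw
    simpa using this
  have hTp : Tay d (a ^ p) = Tay d a ^ p := by
    obtain ⟨q, rfl⟩ : ∃ q, p = q + 1 := ⟨p - 1, by omega⟩
    exact Tay_pow d a q
  rw [← hT, ← hTp] at hw'
  have hc := congrArg (PowerSeries.coeff (p ^ 2)) hw'
  have hpC2 : (p : PowerSeries K) ^ 2 = PowerSeries.C ((p : K) ^ 2) := by simp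
  have hpC3 : (p : PowerSeries K) ^ 3 = PowerSeries.C ((p : K) ^ 3) := by simp
  rw [map_add, map_add, (lin_coeff ha hb p).2.1 _ hp2, hpC2, hpC3, PowerSeries.coeff_C_mul,
    PowerSeries.coeff_C_mul, zero_add, Tay, PowerSeries.coeff_mk, PowerSeries.coeff_mul,
    Finset.Nat.sum_antidiagonal_eq_sum_range_succ_mk, Finset.sum_range_succ',
    (lin_coeff ha hb (p - 1)).2.2] at hc
  have hterm : ∀ k ∈ Finset.range (p ^ 2), ∃ z ∈ O, ((p ^ 2).factorial : K) *
      (PowerSeries.coeff (k + 1) (L ^ (p - 1)) * PowerSeries.coeff (p ^ 2 - (k + 1)) Y) =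
      (p : K) ^ 2 * z := by
    intro k hk
    rw [Finset.mem_range] at hk
    have h1 := (lin_coeff ha hb (p - 1)).1 (k + 1)
    rw [← hL] at h1
    have h2 := hYH (p ^ 2 - (k + 1))
    obtain ⟨u, hu⟩ : p ^ 2 ∣ (p ^ 2).descFactorial (k + 1) := by
      obtain ⟨r, hr⟩ : ∃ r, p ^ 2 = r + 1 := ⟨p ^ 2 - 1, by omega⟩
      rw [hr, Nat.succ_descFactorial_succ]
      exact dvd_mul_right _ _
    have h3 := Nat.factorial_mul_descFactorial (n := p ^ 2) (k := k + 1) (by omega)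
    have h4 : ((p ^ 2 - (k + 1)).factorial : K) * ((p : K) ^ 2 * u) = ((p ^ 2).factorial : K) := by
      rw [← h3, hu]; push_cast; ring
    refine ⟨u * (PowerSeries.coeff (k + 1) (L ^ (p - 1)) *
      (((p ^ 2 - (k + 1)).factorial : K) * PowerSeries.coeff (p ^ 2 - (k + 1)) Y)),
      O.mul_mem (natCast_mem _ _) (O.mul_mem h1 h2), ?_⟩
    rw [← h4]; ring
  obtain ⟨z, hzO, hz⟩ : ∃ z ∈ O, ((p ^ 2).factorial : K) * ∑ k ∈ Finset.range (p ^ 2),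
      (PowerSeries.coeff (k + 1) (L ^ (p - 1)) * PowerSeries.coeff (p ^ 2 - (k + 1)) Y) =
      (p : K) ^ 2 * z := by
    choose! z hz1 hz2 using hterm
    refine ⟨∑ k ∈ Finset.range (p ^ 2), z k, Subring.sum_mem _ hz1, ?_⟩
    rw [Finset.mul_sum, Finset.mul_sum]
    exact Finset.sum_congr rfl hz2
  have hY0 : PowerSeries.coeff (p ^ 2 - 0) Y = ef K (p ^ 2) * y (p ^ 2) := by
    rw [hY, PowerSeries.coeff_mk, Nat.sub_zero, if_pos (by nlinarith)]
  have hWn := hW (p ^ 2)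
  refine ⟨p * z + ((p ^ 2).factorial : K) * PowerSeries.coeff (p ^ 2) W,
    O.add_mem (O.mul_mem (natCast_mem _ _) hzO) hWn, ?_⟩
  have hfe := fac_ef (K := K) (p ^ 2)
  rw [hd (p ^ 2) (by nlinarith)]
  rw [hY0] at hc
  generalize ((p ^ 2).factorial : K) = F at *
  generalize d^[p ^ 2] (a ^ p) = D at *
  generalize ef K (p ^ 2) = e at *
  generalize y (p ^ 2) = yy at *
  linear_combination F * hc - D * hfe + (p : K) ^ 2 * hz + (p : K) ^ 2 * a ^ (p - 1) * yy * hfe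

end Hurwitz

section Final

variable {p : ℕ} [Fact p.Prime]

lemma descF_dvd (hp5 : 5 ≤ p) : ∃ u v : ℕ, p.descFactorial (p - 1) = p * u ∧
    (p - 1 + p - 1).descFactorial (p - 1) = p * v := by
  · obtain ⟨r, hr⟩ : ∃ r, p = r + 2 := ⟨p - 2, by omega⟩
    subst hr
    refine ⟨(r + 1).descFactorial r, (r + 1 + r + 1).descFactorial r, ?_, ?_⟩
    · exact Nat.succ_descFactorial_succ (r + 1) r
    · have e1 : r + 2 - 1 = r + 1 := rfl
      rw [e1, Nat.descFactorial_succ]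
      congr 1; omega

/-- The `p²`-th derivative of `A` lies in `p(A, p)`. -/
lemma step_two (hp5 : 5 ≤ p) {c : Zp p} (hc : 12 * c = 1) (A : MvPolynomial (Fin 3) (Zp p))
    (hw : IsWeightedHomogeneous wt A (p - 1)) (hP : PF A)
    (ha : PhiK (ZMod p) (map (redZ p) A) = 1) :
    (∀ n, 2 ≤ n → ∃ y, (DK c)^[n] A = C (p : Zp p) * y) ∧
    ∃ W U, (DK c)^[p ^ 2] A = C (p : Zp p) * (A * W + C (p : Zp p) * U) := by
  have hp : p.Prime := Fact.out
  have hcr := twelve_red hc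
  have hwr : IsWeightedHomogeneous wt (map (redZ p) A) (p - 1) := by
    intro m hm
    apply hw
    intro h
    rw [coeff_map, h, map_zero] at hm
    exact hm rfl
  have hPr : PF (map (redZ p) A) := by
    rw [PF_iff] at hP ⊢
    intro m hm
    apply hP
    intro h
    rw [coeff_map, h, map_zero] at hm
    exact hm rfl
  have hDD := DD_zero hp5 hcr hwr hPr ha
  have hall : ∀ n, 2 ≤ n → ∃ y, (DK c)^[n] A = C (p : Zp p) * y := by
    intro n hn
    apply red_poly_zero
    rw [DK_iter_map]
    obtain ⟨r, rfl⟩ : ∃ r, n = r + 2 := ⟨n - 2, by omega⟩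
    rw [Function.iterate_add_apply]
    have : (DK (redZ p c))^[2] (map (redZ p) A) = 0 := hDD
    rw [this, iter_zero]
  refine ⟨hall, ?_⟩
  obtain ⟨h, hh⟩ := hall p (by omega)
  obtain ⟨u, v, hu, hv⟩ := descF_dvd hp5
  have hpC : (C (p : Zp p) : MvPolynomial (Fin 3) (Zp p)) ≠ 0 := by
    rw [Ne, C_eq_zero]
    intro h0
    have := congrArg (fun x : Zp p => (x : ℚ)) h0
    simp at this
    exact hp.ne_zero this
  have h1 := pderiv_iter_D_iter c (p - 1) p (p - 1) (by omega) A hP.pderiv (HK_of_wh hw)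
  rw [hh, iter_C_mul, hu, hv] at h1
  have h2 : (pderiv 0)^[p - 1] h =
      C (p : Zp p) * (C ((u : Zp p) * v * c ^ (p - 1)) * (DK c)^[p - (p - 1)] A) := by
    apply mul_left_cancel₀ hpC
    rw [h1]
    simp only [Nat.cast_mul, C_mul]
    ring
  obtain ⟨w, hw3⟩ := Dp_iter hp5 hcr hwr hPr ha c rfl (p - 1) (map (redZ p) h)
  have h3 : (pderiv 0)^[p - 1] (map (redZ p) h) = 0 := by
    rw [← pderiv_iter_map, h2, map_mul, map_C, redZ_p]
    simp
  rw [h3, mul_zero, zero_add] at hw3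
  obtain ⟨W, rfl⟩ := map_surjective (σ := Fin 3) _ (redZ_surj (p := p)) w
  obtain ⟨U, hU⟩ := red_poly_zero (F := (DK c)^[p * (p - 1)] h - A * W) (by
    rw [map_sub, map_mul, ← hw3, DK_iter_map, sub_self])
  refine ⟨W, U, ?_⟩
  have e : p ^ 2 = p * (p - 1) + p := by
    obtain ⟨r, hr⟩ : ∃ r, p = r + 1 := ⟨p - 1, by omega⟩
    rw [hr]; simp; ring
  rw [e, Function.iterate_add_apply, hh, iter_C_mul]
  rw [sub_eq_iff_eq_add'] at hU
  rw [hU]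

lemma final_aux (hp5 : 5 ≤ p) (A : Poly3) (hAiso : Isobaric (p - 1) A) (hAnoP : NoP A)
    (hAint : polyPInt p A) (hAPhi : Phi A = EAs p) :
    InIdealPow p A 3 (Dop^[p ^ 2] (A ^ p)) := by
  have hp : p.Prime := Fact.out
  obtain ⟨A', rfl⟩ := exists_lift hAint
  obtain ⟨c, hc, hcq⟩ := exists_c (p := p) hp5
  have hinj : ∀ m, coeff m A' ≠ 0 → m ∈ (map (Zp p).subtype A').support := by
    intro m hm
    rw [mem_support_iff, coeff_map]
    intro h
    apply hm
    ext
    exact h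
  have hw : IsWeightedHomogeneous wt A' (p - 1) := wh_of fun m hm => hAiso m (hinj m hm)
  have hP : PF A' := (PF_iff _).mpr fun m hm => hAnoP m (hinj m hm)
  rw [Phi_eq, PhiK_map] at hAPhi
  have ha : PhiK (ZMod p) (map (redZ p) A') = 1 := by
    rw [PhiK_map]
    ext n
    have hn := congrArg (PowerSeries.coeff n) hAPhi
    rw [PowerSeries.coeff_map] at hn ⊢
    rw [PowerSeries.coeff_one]
    split_ifs with h0
    · have : PowerSeries.coeff n (PhiK (Zp p) A') = 1 := by
        ext
        rw [h0] at hn ⊢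
        simpa [EAs] using hn
      rw [this, map_one]
    · obtain ⟨y, hy⟩ := EAs_coeff hp5 n h0
      have : PowerSeries.coeff n (PhiK (Zp p) A') = p * y := by
        ext
        rw [hy] at hn
        push_cast
        exact hn
      rw [this, map_mul, redZ_p, zero_mul]
  obtain ⟨hall, W, U, hWU⟩ := step_two hp5 hc A' hw hP ha
  have hDop : Dop = ⇑(DK (1 / 12 : ℚ)) := funext Dop_eq
  rw [hDop]
  have hit : ∀ n, (DK (1 / 12 : ℚ))^[n] (map (Zp p).subtype A') =
      map (Zp p).subtype ((DK c)^[n] A') := by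
    intro n
    rw [DK_iter_map]
    have : (Zp p).subtype c = 1 / 12 := hcq
    rw [this]
  have hpm : map (Zp p).subtype (C (p : Zp p)) = (p : Poly3) := by
    rw [map_C, map_natCast]; simp
  choose! y hy using hall
  obtain ⟨g, ⟨G, rfl⟩, hg⟩ := key_expand (DK (1 / 12 : ℚ))
    (map (Zp p).subtype : MvPolynomial (Fin 3) (Zp p) →+* Poly3).range hp (by omega)
    (map (Zp p).subtype A') ⟨A', rfl⟩ ⟨DK c A', (hit 1).symm⟩
    (fun n => map (Zp p).subtype (y n)) (fun n => ⟨y n, rfl⟩) (fun n hn => by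
      rw [hit, hy n hn, map_mul, hpm])
  rw [hit, hWU] at hg
  rw [hg]
  refine ⟨fun i => if i = 0 then map (Zp p).subtype (G + A' ^ (p - 1) * U) else
    if i = 1 then map (Zp p).subtype W else 0, ?_, ?_⟩
  · intro i
    dsimp only
    split_ifs
    · exact polyPInt_map _
    · exact polyPInt_map _
    · rw [← map_zero (map (Zp p).subtype)]; exact polyPInt_map _
  · simp only [Finset.sum_range_succ, Finset.sum_range_zero, map_mul, map_add, map_pow, hpm]
    have e : map (Zp p).subtype A' ^ p = map (Zp p).subtype A' ^ (p - 1) * map (Zp p).subtype A' := by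
      rw [← pow_succ, Nat.sub_add_cancel hp.one_le]
    simp
    rw [e]
    ring

end Final

theorem stmt_14 (p : ℕ) (hp : p.Prime) (hp5 : 5 ≤ p)
    (A : Poly3) (hAiso : Isobaric (p - 1) A) (hAnoP : NoP A)
    (hAint : polyPInt p A) (hAPhi : Phi A = EAs p) :
    InIdealPow p A 3 (Dop^[p ^ 2] (A ^ p)) := by
  haveI : Fact p.Prime := ⟨hp⟩
  exact final_aux hp5 A hAiso hAnoP hAint hAPhi
end
end

section
/- Let p ≥ 5 be a prime, let k be a positive integer, and let F ∈ ℤ_(p)[Q,R] be isobaric of weight k and not involving P. If F lies in (A^p, p)ⁿ for an integer n ≥ 0, then D^{p²}F lies in (A^p, p)^{n+1}; in other words, v(D^{p²}F) ≥ v(F) + 1. -/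
open MvPolynomial Finset

noncomputable section

namespace Ram

lemma bern_four : bernoulli 4 = -1 / 30 := by
  rw [bernoulli_eq_bernoulli'_of_ne_one (by norm_num), bernoulli'_four]

lemma bern_six : bernoulli 6 = 1 / 42 := by
  rw [bernoulli_eq_bernoulli'_of_ne_one (by norm_num)]
  have h := sum_bernoulli' 7
  have h5 : bernoulli' 5 = 0 := bernoulli'_eq_zero_of_odd (by decide) (by norm_num)
  simp only [Finset.sum_range_succ, Finset.sum_range_zero, bernoulli'_zero, bernoulli'_one,
    bernoulli'_two, bernoulli'_three, bernoulli'_four, h5] at h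
  norm_num [Nat.choose] at h
  linarith

open UpperHalfPlane hiding I
open Complex ModularForm Function.Periodic
open scoped Real MatrixGroups Manifold Topology

/-- `f` has `q`-expansion `a`. -/
def HasQ (f : ℍ → ℂ) (a : PowerSeries ℂ) : Prop :=
  ∀ τ : ℍ, HasSum (fun m : ℕ => a.coeff m • qParam 1 τ ^ m) (f τ)

def th {K : Type*} [CommRing K] (a : PowerSeries K) : PowerSeries K :=
  PowerSeries.mk fun n => (n : K) * a.coeff n

lemma HasQ.add {f g : ℍ → ℂ} {a b : PowerSeries ℂ} (hf : HasQ f a) (hg : HasQ g b) :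
    HasQ (f + g) (a + b) := by
  intro τ
  simpa [add_mul] using (hf τ).add (hg τ)

lemma HasQ.smul {f : ℍ → ℂ} {a : PowerSeries ℂ} (c : ℂ) (hf : HasQ f a) :
    HasQ (c • f) (c • a) := by
  intro τ
  simpa [mul_assoc] using (hf τ).mul_left c

lemma HasQ.mul {f g : ℍ → ℂ} {a b : PowerSeries ℂ} (hf : HasQ f a) (hg : HasQ g b) :
    HasQ (f * g) (a * b) := by
  intro τ
  have h1 := (hf τ).summable.norm
  have h2 := (hg τ).summable.norm
  have h3 := (summable_norm_sum_mul_antidiagonal_of_summable_norm h1 h2).of_norm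
  have h4 := tsum_mul_tsum_eq_tsum_sum_antidiagonal_of_summable_norm h1 h2
  rw [(hf τ).tsum_eq, (hg τ).tsum_eq] at h4
  have h5 := h3.hasSum
  rw [← h4] at h5
  convert! h5 using 1
  ext m
  rw [PowerSeries.coeff_mul, smul_eq_mul, Finset.sum_mul]
  refine Finset.sum_congr rfl fun x hx => ?_
  have hx' : x.1 + x.2 = m := by simpa using hx
  rw [← hx', pow_add]
  simp only [smul_eq_mul]; ring

lemma HasQ.per {f : ℍ → ℂ} {a : PowerSeries ℂ} (hf : HasQ f a) :
    Function.Periodic (f ∘ ofComplex) (1:ℝ) := by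
  intro w
  by_cases hw : 0 < w.im
  · have hw' : 0 < (w + (1:ℝ)).im := by simpa using hw
    simp only [Function.comp]
    rw [ofComplex_apply_of_im_pos hw, ofComplex_apply_of_im_pos hw']
    refine (hf ⟨_, hw'⟩).unique ?_
    have := hf ⟨w, hw⟩
    convert! this using 3
    congr 1
    simp [qParam, mul_add, Complex.exp_add]
  · have hw' : ¬ 0 < (w + (1:ℝ)).im := by simpa using hw
    simp only [Function.comp]
    rw [ofComplex_apply_of_im_nonpos (not_lt.mp hw), ofComplex_apply_of_im_nonpos (not_lt.mp hw')]

lemma HasQ.fps {f : ℍ → ℂ} {a : PowerSeries ℂ} (hf : HasQ f a) (hd : MDiff f) :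
    HasFPowerSeriesOnBall (cuspFunction 1 f) (.ofScalars ℂ fun m => a.coeff m) 0 1 :=
  hasFPowerSeriesOnBall_cuspFunction one_pos
    (analyticAt_cuspFunction_zero one_pos hf.per hd
      (isBoundedAtImInfty_of_hasSum_qExpansion one_pos hf)) hf

lemma HasQ.D {f : ℍ → ℂ} {a : PowerSeries ℂ} (hf : HasQ f a) (hd : MDiff f) :
    HasQ (Derivative.normalizedDerivOfComplex f) (th a) := by
  intro τ
  have h1 := hf.fps hd
  have h2 := (ContinuousLinearMap.apply ℂ ℂ (1 : ℂ)).comp_hasFPowerSeriesOnBall h1.fderiv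
  set q := qParam 1 τ with hq
  have hq1 : ‖q‖ < 1 := norm_qParam_lt_one one_pos τ.im_pos
  have hqm : q ∈ Metric.eball (0:ℂ) 1 := by
    rw [← ENNReal.coe_one, Metric.eball_coe]; simpa using hq1
  have h3 := h2.hasSum hqm
  have h4 : HasDerivAt (cuspFunction 1 f) (deriv (cuspFunction 1 f) q) q := by
    have := h1.analyticOnNhd q hqm
    exact this.differentiableAt.hasDerivAt
  have h5 : HasDerivAt (fun z : ℂ => qParam 1 z) (2 * π * I * q) (τ : ℂ) := by
    have : HasDerivAt (fun z : ℂ => cexp (2 * π * I * z / (1:ℝ))) (cexp (2 * π * I * τ / (1:ℝ)) * (2 * π * I * 1 / (1:ℝ))) (τ : ℂ) :=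
      ((((hasDerivAt_id (τ:ℂ)).const_mul (2 * π * I)).div_const ((1:ℝ):ℂ))).cexp
    convert! this using 1
    simp [hq, qParam]; ring
  have h6 : deriv (f ∘ ofComplex) τ = deriv (cuspFunction 1 f) q * (2 * π * I * q) := by
    have h7 := HasDerivAt.comp (τ : ℂ) (h₂ := cuspFunction 1 f) (by rw [← hq]; exact h4) h5
    rw [← h7.deriv]
    apply Filter.EventuallyEq.deriv_eq
    filter_upwards [isOpen_upperHalfPlaneSet.mem_nhds τ.im_pos] with w hw
    have := eq_cuspFunction (f := f) ⟨w, hw⟩ one_ne_zero hf.per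
    simp only [Function.comp]
    rw [ofComplex_apply_of_im_pos hw]
    exact this.symm
  have h8 : Derivative.normalizedDerivOfComplex f τ = q * deriv (cuspFunction 1 f) q := by
    unfold Derivative.normalizedDerivOfComplex
    rw [h6]
    field_simp
  rw [h8, ← hasSum_nat_add_iff' 1]
  have h9 := h3.mul_left q
  convert! h9 using 1
  · ext m
    simp [th]
    ring
  · simp [th]

lemma HasQ.eq_zero_of_wt {f : ℍ → ℂ} {a : PowerSeries ℂ} (hf : HasQ f a) (hd : MDiff f)
    {k : ℕ} (hk : k < 12) (hs : ∀ γ : SL(2, ℤ), f ∣[(k:ℤ)] γ = f) (h0 : a.coeff 0 = 0) : a = 0 := by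
  let F : ModularForm 𝒮ℒ k :=
    { toFun := f
      slash_action_eq' := fun _ ⟨γ, hγ⟩ ↦ hγ ▸ hs γ
      holo' := hd
      bdd_at_cusps' := fun {c} hc => by
        rw [Subgroup.IsArithmetic.isCusp_iff_isCusp_SL2Z] at hc
        rw [OnePoint.isBoundedAt_iff_forall_SL2Z hc]
        intro γ _
        rw [hs γ]
        exact isBoundedAtImInfty_of_hasSum_qExpansion one_pos hf }
  have hFf : (F : ℍ → ℂ) = f := rfl
  have hc : ∀ m, a.coeff m = (qExpansion 1 F).coeff m := fun m =>
    ModularFormClass.qExpansion_coeff_unique (f := F) (c := fun m => a.coeff m) one_pos one_mem_strictPeriods_SL hf m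
  have hF : F = 0 := by
    apply ModularForm.sturm_bound_levelOne_nat
    rw [Nat.div_eq_of_lt hk]
    have : qExpansion 1 F = a := by ext m; rw [hc]
    rw [this]
    simpa [pos_iff_ne_zero, PowerSeries.order_ne_zero_iff_constCoeff_eq_zero] using h0
  ext m
  rw [hc, hF]
  simp [UpperHalfPlane.qExpansion_zero]

end Ram

namespace Ram
open UpperHalfPlane hiding I
open Complex ModularForm Function.Periodic
open scoped Real MatrixGroups Manifold Topology

open EisensteinSeries Derivative in
lemma E2_ric (γ : SL(2, ℤ)) :
    (normalizedDerivOfComplex E2 - (1/12 : ℂ) • (E2 * E2)) ∣[(4:ℤ)] γ =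
      normalizedDerivOfComplex E2 - (1/12 : ℂ) • (E2 * E2) := by
  set e : ℍ → ℂ := fun z => (6 * I / π) * (γ 1 0 / denom γ z) with he
  have hpi : (π : ℂ) ≠ 0 := by exact_mod_cast Real.pi_ne_zero
  have h1 : E2 ∣[(2:ℤ)] γ = E2 - e := by
    rw [E2_slash_action]
    ext z
    simp [D2, riemannZeta_two, he]
    field_simp
  have hdz : ∀ z : ℍ, HasDerivAt (e ∘ ofComplex) ((6 * I / π) * (-(γ 1 0)^2 / denom γ z ^ 2)) (z:ℂ) := by
    intro z
    have := hasDerivAt_denom_zpow (γ : GL (Fin 2) ℝ) (-1) z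
    have h2 := this.const_mul ((6 * I / π) * (γ 1 0))
    have h3 := h2.congr_of_eventuallyEq (f₁ := e ∘ ofComplex) (by
      filter_upwards [isOpen_upperHalfPlaneSet.mem_nhds z.im_pos] with w hw
      simp [he, ofComplex_apply_of_im_pos hw]
      ring)
    convert! h3 using 1
    have hz := denom_ne_zero (γ : GL (Fin 2) ℝ) z
    simp
    field_simp
  have hmd : MDiff e := by
    intro z
    exact mdifferentiableAt_iff.mpr (hdz z).differentiableAt
  have hD := normalizedDerivOfComplex_SL_slash (k := 2) (F := E2) E2_mdifferentiable (γ := γ)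
  rw [h1, normalizedDerivOfComplex_sub _ _ E2_mdifferentiable hmd] at hD
  have hm := ModularForm.mul_slash_SL2 2 2 γ E2 E2
  rw [h1] at hm
  norm_num at hm hD
  rw [sub_eq_add_neg, SlashAction.add_slash, SlashAction.neg_slash, ModularForm.SL_smul_slash, hm]
  ext z
  have hDz := congrFun hD z
  have hez : normalizedDerivOfComplex e z = (2 * π * I)⁻¹ * ((6 * I / π) * (-(γ 1 0)^2 / denom γ z ^ 2)) := by
    rw [normalizedDerivOfComplex, (hdz z).deriv]
  simp only [Pi.sub_apply, hez] at hDz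
  simp only [Pi.add_apply, Pi.neg_apply, Pi.smul_apply, Pi.mul_apply, Pi.sub_apply, smul_eq_mul]
  have h5 := eq_add_of_sub_eq hDz.symm
  rw [h5]
  simp only [he]
  have hz := denom_ne_zero (γ : GL (Fin 2) ℝ) z
  field_simp
  ring_nf
  simp

lemma slash_ME {k : ℤ} (f : ModularForm 𝒮ℒ k) (γ : SL(2, ℤ)) : (f : ℍ → ℂ) ∣[k] γ = f :=
  SlashInvariantForm.slash_action_eqn f _ ⟨γ, rfl⟩

lemma sigmaQ_cast (j n : ℕ) : ((sigmaQ j n : ℚ) : ℂ) = (ArithmeticFunction.sigma j n : ℂ) := by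
  simp [sigmaQ, ArithmeticFunction.sigma_apply]

def cm : PowerSeries ℚ →+* PowerSeries ℂ := PowerSeries.map (algebraMap ℚ ℂ)

lemma cm_inj : Function.Injective cm :=
  PowerSeries.map_injective _ (algebraMap ℚ ℂ).injective

lemma cm_th (a : PowerSeries ℚ) : cm (th a) = th (cm a) := by
  ext m; simp [cm, th]

lemma hasQ_E2 : HasQ EisensteinSeries.E2 (cm E2s) := by
  intro τ
  convert! EisensteinSeries.hasSum_qExpansion_E2 (z := τ) using 3 with m
  · simp only [cm, E2s, PowerSeries.coeff_map, PowerSeries.coeff_mk]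
    split_ifs <;> simp [sigmaQ_cast]
  · simp [qParam]

lemma hasQ_E4 : HasQ (E₄ : ℍ → ℂ) (cm E4s) := by
  intro τ
  convert! ModularForm.hasSum_qExpansion (f := E₄) one_pos one_mem_strictPeriods_SL τ using 3 with m
  rw [EisensteinSeries.E_qExpansion_coeff _ ⟨2, rfl⟩]
  simp only [cm, E4s, PowerSeries.coeff_map, PowerSeries.coeff_mk]
  split_ifs
  · simp
  · norm_num [sigmaQ_cast, bern_four]

lemma hasQ_E6 : HasQ (E₆ : ℍ → ℂ) (cm E6s) := by
  intro τ
  convert! ModularForm.hasSum_qExpansion (f := E₆) one_pos one_mem_strictPeriods_SL τ using 3 with m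
  rw [EisensteinSeries.E_qExpansion_coeff _ ⟨3, rfl⟩]
  simp only [cm, E6s, PowerSeries.coeff_map, PowerSeries.coeff_mk]
  split_ifs
  · simp
  · norm_num [sigmaQ_cast, bern_six]

lemma c0 : E2s.coeff 0 = 1 ∧ E4s.coeff 0 = 1 ∧ E6s.coeff 0 = 1 := by simp [E2s, E4s, E6s]

lemma cc0 : PowerSeries.constantCoeff E2s = 1 ∧ PowerSeries.constantCoeff E4s = 1 ∧
    PowerSeries.constantCoeff E6s = 1 := by
  simpa using c0

lemma thc0 {K : Type*} [CommRing K] (a : PowerSeries K) : PowerSeries.constantCoeff (th a) = 0 := by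
  rw [← PowerSeries.coeff_zero_eq_constantCoeff_apply]; simp [th]

lemma cm_smul (c : ℚ) (a : PowerSeries ℚ) : cm (c • a) = (c : ℂ) • cm a := by
  ext m; simp [cm]

lemma cmc (a : PowerSeries ℚ) : PowerSeries.constantCoeff (cm a) = (PowerSeries.constantCoeff a : ℚ) := by
  rw [← PowerSeries.coeff_zero_eq_constantCoeff_apply]; simp [cm]

open EisensteinSeries Derivative

theorem ram1 : th E2s = (1/12 : ℚ) • (E2s ^ 2 - E4s) := by
  have hq := ((hasQ_E2.D E2_mdifferentiable).add ((hasQ_E2.mul hasQ_E2).smul (-1/12))).add (hasQ_E4.smul (1/12))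
  have h := hq.eq_zero_of_wt (k := 4)
    (((normalizedDerivOfComplex_mdifferentiable E2_mdifferentiable).add
      ((E2_mdifferentiable.mul E2_mdifferentiable).const_smul _)).add
      ((ModularFormClass.holo E₄).const_smul _)) (by norm_num) (by
      intro γ
      rw [SlashAction.add_slash]
      congr 1
      · have he : normalizedDerivOfComplex E2 + (-1/12 : ℂ) • (E2 * E2) =
            normalizedDerivOfComplex E2 - (1/12 : ℂ) • (E2 * E2) := by
          ext z; simp; ring
        rw [he]
        exact E2_ric γ
      · rw [ModularForm.SL_smul_slash]
        congr 1
        exact slash_ME E₄ γ) (by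
      simp [thc0, cmc, cc0]
      norm_num)
  apply cm_inj
  rw [cm_smul, map_sub, map_pow, cm_th]
  ext m
  have := congrArg (PowerSeries.coeff m) h
  simp only [map_add, map_smul, map_zero, smul_eq_mul, map_sub, pow_two] at this ⊢
  push_cast
  linear_combination this

theorem ram2 : th E4s = (1/3 : ℚ) • (E2s * E4s - E6s) := by
  have hq := ((hasQ_E4.D (ModularFormClass.holo E₄)).add ((hasQ_E2.mul hasQ_E4).smul (-1/3))).add (hasQ_E6.smul (1/3))
  have h := hq.eq_zero_of_wt (k := 6)
    (((normalizedDerivOfComplex_mdifferentiable (ModularFormClass.holo E₄)).add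
      ((E2_mdifferentiable.mul (ModularFormClass.holo E₄)).const_smul _)).add
      ((ModularFormClass.holo E₆).const_smul _)) (by norm_num) (by
      intro γ
      rw [SlashAction.add_slash]
      congr 1
      · have he : normalizedDerivOfComplex E₄ + (-1/3 : ℂ) • (E2 * E₄) =
            serreDerivative ((4:ℤ):ℂ) E₄ := by
          ext z; simp; ring
        rw [he]
        exact serreDerivative_slash_invariant (k := 4) (ModularFormClass.holo E₄) (slash_ME E₄ γ)
      · rw [ModularForm.SL_smul_slash]
        congr 1
        exact slash_ME E₆ γ) (by
      simp [thc0, cmc, cc0]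
      norm_num)
  apply cm_inj
  rw [cm_smul, map_sub, map_mul, cm_th]
  ext m
  have := congrArg (PowerSeries.coeff m) h
  simp only [map_add, map_smul, map_zero, smul_eq_mul, map_sub] at this ⊢
  push_cast
  linear_combination this

theorem ram3 : th E6s = (1/2 : ℚ) • (E2s * E6s - E4s ^ 2) := by
  have hq := ((hasQ_E6.D (ModularFormClass.holo E₆)).add ((hasQ_E2.mul hasQ_E6).smul (-1/2))).add ((hasQ_E4.mul hasQ_E4).smul (1/2))
  have h := hq.eq_zero_of_wt (k := 8)
    (((normalizedDerivOfComplex_mdifferentiable (ModularFormClass.holo E₆)).add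
      ((E2_mdifferentiable.mul (ModularFormClass.holo E₆)).const_smul _)).add
      (((ModularFormClass.holo E₄).mul (ModularFormClass.holo E₄)).const_smul _)) (by norm_num) (by
      intro γ
      rw [SlashAction.add_slash]
      congr 1
      · have he : normalizedDerivOfComplex E₆ + (-1/2 : ℂ) • (E2 * E₆) =
            serreDerivative ((6:ℤ):ℂ) E₆ := by
          ext z; simp; ring
        rw [he]
        exact serreDerivative_slash_invariant (k := 6) (ModularFormClass.holo E₆) (slash_ME E₆ γ)
      · rw [ModularForm.SL_smul_slash]
        congr 1
        have := ModularForm.mul_slash_SL2 4 4 γ E₄ E₄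
        rw [slash_ME E₄ γ] at this
        exact this) (by
      simp [thc0, cmc, cc0]
      norm_num)
  apply cm_inj
  rw [cm_smul, map_sub, map_mul, map_pow, cm_th]
  ext m
  have := congrArg (PowerSeries.coeff m) h
  simp only [map_add, map_smul, map_zero, smul_eq_mul, map_sub, pow_two] at this ⊢
  push_cast
  linear_combination this

end Ram

namespace Ram

/-- The general Leibniz rule. -/
theorem iter_leib {K S : Type*} [CommRing K] [CommRing S] [Algebra K S] (D : Derivation K S S)
    (n : ℕ) (a b : S) :
    D^[n] (a * b) = ∑ ij ∈ antidiagonal n, n.choose ij.1 • (D^[ij.1] a * D^[ij.2] b) := by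
  induction n with
  | zero => simp
  | succ n ih =>
    rw [sum_antidiagonal_choose_succ_nsmul (M := S) (fun i j => D^[i] a * D^[j] b) n]
    simp only [Function.iterate_succ_apply', ih, map_sum, map_nsmul, Derivation.leibniz, smul_add,
      sum_add_distrib, smul_eq_mul]
    congr 1
    refine sum_congr rfl fun ⟨i, j⟩ hij ↦ ?_
    have hij' : i + j = n := by simpa using hij
    rw [n.choose_symm_of_eq_add hij'.symm, mul_comm]

section gen
variable {K : Type*} [CommRing K]

abbrev S3 (K : Type*) [CommRing K] := MvPolynomial (Fin 3) K

/-- The derivation, with `c` playing the role of `1/12`. -/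
def DK (c : K) : Derivation K (S3 K) (S3 K) :=
  mkDerivation K ![C c * (X 0 ^ 2 - X 1), C (4 * c) * (X 0 * X 1 - X 2),
    C (6 * c) * (X 0 * X 2 - X 1 ^ 2)]

lemma der_eq (D : Derivation K (S3 K) (S3 K)) (f : S3 K) :
    D f = D (X 0) * pderiv 0 f + D (X 1) * pderiv 1 f + D (X 2) * pderiv 2 f := by
  have : D = D (X 0) • pderiv 0 + D (X 1) • pderiv 1 + D (X 2) • pderiv 2 := by
    apply MvPolynomial.derivation_ext
    intro i
    fin_cases i <;> simp
  conv_lhs => rw [this]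
  simp

lemma DK_X0 (c : K) : DK c (X 0) = C c * (X 0 ^ 2 - X 1) := by simp [DK, mkDerivation_X]
lemma DK_X1 (c : K) : DK c (X 1) = C (4 * c) * (X 0 * X 1 - X 2) := by simp [DK, mkDerivation_X]
lemma DK_X2 (c : K) : DK c (X 2) = C (6 * c) * (X 0 * X 2 - X 1 ^ 2) := by simp [DK, mkDerivation_X]

lemma DK_eq (c : K) (f : S3 K) : DK c f = C c * (X 0 ^ 2 - X 1) * pderiv 0 f
    + C (4 * c) * (X 0 * X 1 - X 2) * pderiv 1 f
    + C (6 * c) * (X 0 * X 2 - X 1 ^ 2) * pderiv 2 f := by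
  rw [der_eq, DK_X0, DK_X1, DK_X2]

lemma Dop_eq (f : Poly3) : Dop f = DK (1/12 : ℚ) f := by
  rw [DK_eq, Dop]; norm_num

lemma map_DK {L : Type*} [CommRing L] (φ : K →+* L) (c : K) (f : S3 K) :
    map φ (DK c f) = DK (φ c) (map φ f) := by
  rw [DK_eq, DK_eq]
  have h4 : φ 4 = 4 := map_ofNat φ 4
  have h6 : φ 6 = 6 := map_ofNat φ 6
  simp [pderiv_map, h4, h6]

lemma map_DK_iter {L : Type*} [CommRing L] (φ : K →+* L) (c : K) (n : ℕ) (f : S3 K) :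
    map φ ((DK c)^[n] f) = (DK (φ c))^[n] (map φ f) := by
  induction n with
  | zero => rfl
  | succ n ih => rw [Function.iterate_succ_apply', Function.iterate_succ_apply', map_DK, ih]

/-- No `P`. -/
def NP (f : S3 K) : Prop := ∀ m : Fin 3 →₀ ℕ, m 0 ≠ 0 → coeff m f = 0

abbrev wt3 : Fin 3 → ℕ := ![2, 4, 6]

abbrev Iso (k : ℕ) (f : S3 K) : Prop := IsWeightedHomogeneous wt3 f k

lemma wt_eq (m : Fin 3 →₀ ℕ) : Finsupp.weight wt3 m = 2 * m 0 + 4 * m 1 + 6 * m 2 := by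
  rw [Finsupp.weight_eq_sum]; simp [Fin.sum_univ_three, wt3]; ring

lemma Iso.mulpd {f g : S3 K} {k j : ℕ} (hf : Iso k f) (i : Fin 3) (hg : Iso (j + wt3 i) g) :
    Iso (k + j) (g * pderiv i f) := by
  intro d hd
  rw [coeff_mul] at hd
  obtain ⟨⟨a, b⟩, hab, hne⟩ := Finset.exists_ne_zero_of_sum_ne_zero hd
  have hab' : a + b = d := by simpa using hab
  have ha := hg (left_ne_zero_of_mul hne)
  have hb := right_ne_zero_of_mul hne
  rw [coeff_pderiv] at hb
  have hb' := hf (left_ne_zero_of_mul hb)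
  rw [map_add, Finsupp.weight_single] at hb'
  rw [← hab', map_add, ha, ← hb']
  simp; ring

lemma iX0 : Iso 2 (X 0 : S3 K) := isWeightedHomogeneous_X _ _ 0
lemma iX1 : Iso 4 (X 1 : S3 K) := isWeightedHomogeneous_X _ _ 1
lemma iX2 : Iso 6 (X 2 : S3 K) := isWeightedHomogeneous_X _ _ 2

lemma Iso.DK {f : S3 K} {k : ℕ} (c : K) (hf : Iso k f) : Iso (k + 2) (DK c f) := by
  rw [DK_eq]
  refine ((hf.mulpd 0 ?_).add (hf.mulpd 1 ?_)).add (hf.mulpd 2 ?_)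
  · exact ((iX0.pow 2).sub iX1).C_mul _
  · exact ((iX0.mul iX1).sub iX2).C_mul _
  · exact ((iX0.mul iX2).sub (iX1.pow 2)).C_mul _

lemma Iso.DKn {f : S3 K} {k : ℕ} (c : K) (n : ℕ) (hf : Iso k f) : Iso (k + 2 * n) ((Ram.DK c)^[n] f) := by
  induction n with
  | zero => exact hf
  | succ n ih => rw [Function.iterate_succ_apply']; exact ih.DK c

lemma Iso.euler {f : S3 K} {k : ℕ} (hf : Iso k f) :
    2 * (X 0 * pderiv 0 f) + 4 * (X 1 * pderiv 1 f) + 6 * (X 2 * pderiv 2 f) = (k : S3 K) * f := by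
  have := hf.sum_weight_X_mul_pderiv
  simpa [Fin.sum_univ_three, wt3] using this

lemma pd_comm (i j : Fin 3) (f : S3 K) : pderiv i (pderiv j f) = pderiv j (pderiv i f) := by
  ext m
  rw [coeff_pderiv, coeff_pderiv, coeff_pderiv, coeff_pderiv, add_right_comm]
  by_cases h : i = j
  · subst h; ring
  · simp [h, Ne.symm h]; ring

/-- Commutator of `∂/∂P` and `D`. -/
lemma comm_pd {f : S3 K} {k : ℕ} (c : K) (hf : Iso k f) :
    pderiv 0 (DK c f) = DK c (pderiv 0 f) + C (c * k) * f := by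
  have h := hf.euler
  have h2 : C (c * k) * f = C c * ((k : S3 K) * f) := by simp; ring
  rw [h2, ← h]
  rw [DK_eq, DK_eq]
  simp only [map_add, pderiv_mul, pderiv_C, map_sub, pderiv_pow, pderiv_X_self,
    pderiv_X_of_ne (show (1 : Fin 3) ≠ 0 by decide), pderiv_X_of_ne (show (2 : Fin 3) ≠ 0 by decide),
    pd_comm 0 1, pd_comm 0 2]
  have h4 : (C 4 : S3 K) = 4 := map_ofNat C 4
  have h6 : (C 6 : S3 K) = 6 := map_ofNat C 6
  simp [h4, h6]
  ring

lemma comm_pd_iter {f : S3 K} {k : ℕ} (c : K) (hf : Iso k f) (h0 : pderiv 0 f = 0) (n : ℕ) :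
    pderiv 0 ((DK c)^[n + 1] f) = C (c * ((n + 1) * (k + n))) * (DK c)^[n] f := by
  induction n with
  | zero =>
    have := comm_pd c hf
    simp [h0] at this
    simp [this]
  | succ n ih =>
    rw [Function.iterate_succ_apply', comm_pd c (hf.DKn c (n+1)), ih, ← smul_eq_C_mul, Derivation.map_smul,
      ← Function.iterate_succ_apply' (DK c) n, smul_eq_C_mul, ← add_mul, ← C_add]
    congr 2
    push_cast; ring

lemma pd_desc {f : S3 K} {k : ℕ} (c : K) (hk : 0 < k) (hf : Iso k f) (h0 : pderiv 0 f = 0) (n j : ℕ) :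
    (pderiv 0)^[j] ((DK c)^[n] f) =
      C (c ^ j * (n.descFactorial j * (k + n - 1).descFactorial j : ℕ)) * (DK c)^[n - j] f := by
  induction j with
  | zero => simp
  | succ j ih =>
    rw [Function.iterate_succ_apply', ih, pderiv_C_mul]
    by_cases hj : j < n
    · obtain ⟨t, rfl⟩ := Nat.exists_eq_add_of_lt hj
      rw [show j + t + 1 - j = t + 1 by omega, comm_pd_iter c hf h0, ← mul_assoc, ← C_mul,
        show j + t + 1 - (j + 1) = t by omega, Nat.descFactorial_succ, Nat.descFactorial_succ]
      congr 2
      rw [show j + t + 1 - j = t + 1 by omega, show k + (j + t + 1) - 1 - j = k + t by omega]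
      push_cast; ring
    · rw [show n - j = 0 by omega, Nat.descFactorial_of_lt (show n < j + 1 by omega)]
      simp [h0]

lemma coeff_pd_iter (f : S3 K) (j : ℕ) (m : Fin 3 →₀ ℕ) (hm : m 0 = 0) :
    coeff m ((pderiv 0)^[j] f) = j.factorial * coeff (m + Finsupp.single 0 j) f := by
  induction j generalizing f with
  | zero => simp
  | succ j ih =>
    rw [Function.iterate_succ_apply, ih, coeff_pderiv, add_assoc, ← Finsupp.single_add]
    simp [hm, Nat.factorial_succ]; ring

lemma NP.pd {f : S3 K} (hf : NP f) : pderiv 0 f = 0 := by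
  ext m
  rw [coeff_pderiv, hf _ (by simp)]; simp

lemma dvd_aux (p k j : ℕ) (hp : p.Prime) (hj : j ≠ 0) :
    p ∣ p.choose j * (k + p - 1).descFactorial j := by
  rcases lt_trichotomy j p with h | h | h
  · exact Dvd.dvd.mul_right (hp.dvd_choose_self hj h) _
  · subst h
    exact Dvd.dvd.mul_left ((Nat.dvd_factorial hp.pos le_rfl).trans (Nat.factorial_dvd_descFactorial _ _)) _
  · simp [Nat.choose_eq_zero_of_lt h]

/-- In characteristic zero, the coefficients of monomials with `P` in `D^p f` are
divisible by `p`. -/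
lemma dvd_coeff [IsDomain K] [CharZero K] {f : S3 K} {k : ℕ} (c : K) (hk : 0 < k) (hf : Iso k f)
    (hN : NP f) (p : ℕ) (hp : p.Prime) (m : Fin 3 →₀ ℕ) (hm : m 0 ≠ 0) :
    (p : K) ∣ coeff m ((DK c)^[p] f) := by
  classical
  set j := m 0 with hj
  set m' := m.erase 0 with hm'
  have hmm : m = m' + Finsupp.single 0 j := by
    rw [hm', hj]; exact (Finsupp.erase_add_single 0 m).symm
  have h1 := congrArg (coeff m') (pd_desc c hk hf hN.pd p j)
  rw [coeff_pd_iter _ _ _ (by simp [hm']), ← hmm, coeff_C_mul, Nat.descFactorial_eq_factorial_mul_choose p j] at h1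
  obtain ⟨t, ht⟩ := dvd_aux p k j hp hm
  have hf0 : (j.factorial : K) ≠ 0 := by exact_mod_cast j.factorial_ne_zero
  rw [mul_assoc j.factorial, ht] at h1
  refine ⟨c ^ j * t * coeff m' ((DK c)^[p - j] f), mul_left_cancel₀ hf0 ?_⟩
  rw [h1]; push_cast; ring

end gen
end Ram

namespace Ram

section phi
variable (K : Type*) [CommRing K]

def e2 : PowerSeries K := PowerSeries.mk fun n =>
  if n = 0 then 1 else -24 * ((ArithmeticFunction.sigma 1 n : ℕ) : K)
def e4 : PowerSeries K := PowerSeries.mk fun n =>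
  if n = 0 then 1 else 240 * ((ArithmeticFunction.sigma 3 n : ℕ) : K)
def e6 : PowerSeries K := PowerSeries.mk fun n =>
  if n = 0 then 1 else -504 * ((ArithmeticFunction.sigma 5 n : ℕ) : K)

def ph : S3 K →ₐ[K] PowerSeries K := aeval ![e2 K, e4 K, e6 K]

variable {K}
lemma map_e {L : Type*} [CommRing L] (φ : K →+* L) : PowerSeries.map φ (e2 K) = e2 L ∧
    PowerSeries.map φ (e4 K) = e4 L ∧ PowerSeries.map φ (e6 K) = e6 L := by
  have h24 : φ 24 = 24 := map_ofNat φ 24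
  have h240 : φ 240 = 240 := map_ofNat φ 240
  have h504 : φ 504 = 504 := map_ofNat φ 504
  refine ⟨?_, ?_, ?_⟩ <;> ext n <;> by_cases h : n = 0 <;> simp [e2, e4, e6, h, h24, h240, h504]

lemma map_th {L : Type*} [CommRing L] (φ : K →+* L) (a : PowerSeries K) :
    PowerSeries.map φ (th a) = th (PowerSeries.map φ a) := by
  ext n; simp [th]

lemma e_Q : e2 ℚ = E2s ∧ e4 ℚ = E4s ∧ e6 ℚ = E6s := by
  refine ⟨?_, ?_, ?_⟩ <;> ext n <;> by_cases h : n = 0 <;>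
    simp [e2, e4, e6, E2s, E4s, E6s, h, sigmaQ, ArithmeticFunction.sigma_apply]

lemma map_ph {L : Type*} [CommRing L] (φ : K →+* L) (f : S3 K) :
    PowerSeries.map φ (ph K f) = ph L (map φ f) := by
  obtain ⟨h2, h4, h6⟩ := map_e φ
  have : (PowerSeries.map φ).comp (ph K).toRingHom = (ph L).toRingHom.comp (map φ) := by
    apply MvPolynomial.ringHom_ext
    · intro r
      simp [ph]
    · intro i
      fin_cases i <;> simp [ph, h2, h4, h6]
  exact RingHom.congr_fun this f

lemma Phi_eq (f : Poly3) : Phi f = ph ℚ f := by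
  rw [Phi, ph, e_Q.1, e_Q.2.1, e_Q.2.2]

lemma ramZ : 12 * th (e2 ℤ) = e2 ℤ ^ 2 - e4 ℤ ∧ 3 * th (e4 ℤ) = e2 ℤ * e4 ℤ - e6 ℤ ∧
    2 * th (e6 ℤ) = e2 ℤ * e6 ℤ - e4 ℤ ^ 2 := by
  obtain ⟨h2, h4, h6⟩ := map_e (Int.castRingHom ℚ)
  have hi := PowerSeries.map_injective (Int.castRingHom ℚ) Int.cast_injective
  refine ⟨hi ?_, hi ?_, hi ?_⟩
  · simp only [map_mul, map_sub, map_pow, map_th, h2, h4, h6, e_Q, ram1, map_ofNat]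
    rw [PowerSeries.smul_eq_C_mul, ← mul_assoc, show (12 : PowerSeries ℚ) = PowerSeries.C 12 from (map_ofNat _ 12).symm, ← map_mul]
    norm_num
  · simp only [map_mul, map_sub, map_th, h2, h4, h6, e_Q, ram2, map_ofNat]
    rw [PowerSeries.smul_eq_C_mul, ← mul_assoc, show (3 : PowerSeries ℚ) = PowerSeries.C 3 from (map_ofNat _ 3).symm, ← map_mul]
    norm_num
  · simp only [map_mul, map_sub, map_pow, map_th, h2, h4, h6, e_Q, ram3, map_ofNat]
    rw [PowerSeries.smul_eq_C_mul, ← mul_assoc, show (2 : PowerSeries ℚ) = PowerSeries.C 2 from (map_ofNat _ 2).symm, ← map_mul]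
    norm_num

variable (K) in
lemma ramK : 12 * th (e2 K) = e2 K ^ 2 - e4 K ∧ 3 * th (e4 K) = e2 K * e4 K - e6 K ∧
    2 * th (e6 K) = e2 K * e6 K - e4 K ^ 2 := by
  obtain ⟨h2, h4, h6⟩ := map_e (Int.castRingHom K)
  obtain ⟨r1, r2, r3⟩ := ramZ
  refine ⟨?_, ?_, ?_⟩
  · have hn : PowerSeries.map (Int.castRingHom K) 12 = 12 := map_ofNat _ 12
    simpa [map_th, h2, h4, h6, hn] using congrArg (PowerSeries.map (Int.castRingHom K)) r1
  · have hn : PowerSeries.map (Int.castRingHom K) 3 = 3 := map_ofNat _ 3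
    simpa [map_th, h2, h4, h6, hn] using congrArg (PowerSeries.map (Int.castRingHom K)) r2
  · have hn : PowerSeries.map (Int.castRingHom K) 2 = 2 := map_ofNat _ 2
    simpa [map_th, h2, h4, h6, hn] using congrArg (PowerSeries.map (Int.castRingHom K)) r3

lemma th_add (a b : PowerSeries K) : th (a + b) = th a + th b := by
  ext n; simp [th, mul_add]

lemma th_mul (a b : PowerSeries K) : th (a * b) = th a * b + a * th b := by
  ext n
  simp only [th, map_add, PowerSeries.coeff_mk, PowerSeries.coeff_mul, Finset.mul_sum,
    ← Finset.sum_add_distrib]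
  refine Finset.sum_congr rfl fun x hx => ?_
  have hx' : x.1 + x.2 = n := by simpa using hx
  rw [← hx']; push_cast; ring

lemma th_C (a : K) : th (PowerSeries.C a) = 0 := by
  ext n
  by_cases h : n = 0 <;> simp [th, PowerSeries.coeff_C, h]

lemma ph_X : ph K (X 0) = e2 K ∧ ph K (X 1) = e4 K ∧ ph K (X 2) = e6 K := by simp [ph]

lemma ph_C (a : K) : ph K (C a) = PowerSeries.C a := by
  simp [ph]

lemma ph_DK (c : K) (hc : 12 * c = 1) (f : S3 K) : ph K (DK c f) = th (ph K f) := by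
  obtain ⟨r1, r2, r3⟩ := ramK K
  obtain ⟨p0, p1, p2⟩ := ph_X (K := K)
  have hcc : (12 : PowerSeries K) * PowerSeries.C c = 1 := by
    rw [show (12 : PowerSeries K) = PowerSeries.C 12 from (map_ofNat _ 12).symm, ← map_mul, hc, map_one]
  have c4 : (PowerSeries.C 4 : PowerSeries K) = 4 := map_ofNat _ 4
  have c6 : (PowerSeries.C 6 : PowerSeries K) = 6 := map_ofNat _ 6
  induction f using MvPolynomial.induction_on with
  | C a => rw [derivation_C, map_zero, ph_C, th_C]
  | add f g hf hg => rw [map_add, map_add, map_add, th_add, hf, hg]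
  | mul_X f i hf =>
    rw [Derivation.leibniz, map_add, map_mul, th_mul, smul_eq_mul, smul_eq_mul, map_mul, map_mul, hf]
    have : ph K (DK c (X i)) = th (ph K (X i)) := by
      fin_cases i
      · simp only [Fin.zero_eta, Fin.isValue, DK_X0, map_mul, map_sub, map_pow, p0, p1, ph_C]
        linear_combination -PowerSeries.C c * r1 + th (e2 K) * hcc
      · simp only [Fin.mk_one, Fin.isValue, DK_X1, map_mul, map_sub, p0, p1, p2, ph_C, c4]
        linear_combination -4 * PowerSeries.C c * r2 + th (e4 K) * hcc
      · simp only [Fin.reduceFinMk, Fin.isValue, DK_X2, map_mul, map_sub, map_pow, p0, p1, p2, ph_C, c6]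
        linear_combination -6 * PowerSeries.C c * r3 + th (e6 K) * hcc
    rw [this]; ring

lemma ph_DK_iter (c : K) (hc : 12 * c = 1) (n : ℕ) (f : S3 K) :
    ph K ((DK c)^[n] f) = th^[n] (ph K f) := by
  induction n with
  | zero => rfl
  | succ n ih => rw [Function.iterate_succ_apply', Function.iterate_succ_apply', ph_DK c hc, ih]

lemma th_iter_coeff (n m : ℕ) (a : PowerSeries K) :
    (th^[n] a).coeff m = (m : K) ^ n * a.coeff m := by
  induction n with
  | zero => simp
  | succ n ih => rw [Function.iterate_succ_apply']; simp [th, ih, pow_succ]; ring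

/-! Injectivity -/

lemma np_mono (a b : ℕ) (c : K) : NP (C c * X 1 ^ a * X 2 ^ b) := by
  intro m hm
  have : (C c * X 1 ^ a * X 2 ^ b : S3 K) = monomial (Finsupp.single 1 a + Finsupp.single 2 b) c := by
    rw [X_pow_eq_monomial, X_pow_eq_monomial, C_mul_monomial, monomial_mul]; simp
  rw [this, coeff_monomial, if_neg]
  rintro rfl
  simp at hm

lemma NP.add {f g : S3 K} (hf : NP f) (hg : NP g) : NP (f + g) := by
  intro m hm; simp [hf m hm, hg m hm]

lemma NP.sub {f g : S3 K} (hf : NP f) (hg : NP g) : NP (f - g) := by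
  intro m hm; simp [hf m hm, hg m hm]

lemma NP.mul {f g : S3 K} (hf : NP f) (hg : NP g) : NP (f * g) := by
  intro m hm
  rw [coeff_mul]
  refine Finset.sum_eq_zero fun x hx => ?_
  have hx' : x.1 + x.2 = m := by simpa using hx
  have : x.1 0 ≠ 0 ∨ x.2 0 ≠ 0 := by
    by_contra h
    push Not at h
    apply hm
    rw [← hx']
    simp [h.1, h.2]
  rcases this with h | h
  · rw [hf _ h, zero_mul]
  · rw [hg _ h, mul_zero]

lemma np_zero : NP (0 : S3 K) := fun m _ => by simp
lemma np_C (c : K) : NP (C c : S3 K) := by simpa using np_mono 0 0 c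
lemma np_X1 : NP (X 1 : S3 K) := by simpa using np_mono 1 0 (1:K)
lemma np_X2 : NP (X 2 : S3 K) := by simpa using np_mono 0 1 (1:K)
lemma NP.pow {f : S3 K} (hf : NP f) (n : ℕ) : NP (f ^ n) := by
  induction n with
  | zero => simpa using np_C (1:K)
  | succ n ih => rw [pow_succ]; exact ih.mul hf
lemma NP.sum {ι : Type*} (s : Finset ι) (f : ι → S3 K) (h : ∀ i ∈ s, NP (f i)) : NP (∑ i ∈ s, f i) := by
  intro m hm
  rw [coeff_sum]
  exact Finset.sum_eq_zero fun i hi => h i hi m hm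
lemma NP.pdi {f : S3 K} (hf : NP f) (i : Fin 3) : NP (pderiv i f) := by
  intro m hm
  rw [coeff_pderiv, hf, zero_mul]
  simp; intro h; exact absurd h hm

lemma red_mono (c : K) (w a b : ℕ) (hw : 4 * a + 6 * b = w) :
    ∃ g : S3 K, NP g ∧ Iso (w - 12) g ∧ (w < 12 → g = 0) ∧
      C c * X 1 ^ a * X 2 ^ b =
        C c * X 1 ^ ((w - 6 * (w / 2 % 2)) / 4) * X 2 ^ (w / 2 % 2) + (X 1 ^ 3 - X 2 ^ 2) * g := by
  induction b using Nat.strong_induction_on generalizing a with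
  | _ b ih =>
    by_cases hb : b < 2
    · refine ⟨0, np_zero, isWeightedHomogeneous_zero _ _ _, fun _ => rfl, ?_⟩
      have h1 : w / 2 % 2 = b := by omega
      have h2 : (w - 6 * b) / 4 = a := by omega
      rw [h1, h2]; simp
    · obtain ⟨g, hg1, hg2, hg3, hg4⟩ := ih (b - 2) (by omega) (a + 3) (by omega)
      refine ⟨g - C c * X 1 ^ a * X 2 ^ (b - 2), hg1.sub (np_mono _ _ _), hg2.sub ?_, by omega, ?_⟩
      · have := ((iX1 (K := K).pow a).C_mul c).mul (iX2 (K := K).pow (b - 2))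
        convert! this using 1
        simp; omega
      · obtain ⟨t, rfl⟩ : ∃ t, b = t + 2 := ⟨b - 2, by omega⟩
        simp only [Nat.add_sub_cancel] at hg4 ⊢
        rw [mul_sub, ← add_sub_assoc, ← hg4]
        ring

lemma red {f : S3 K} {w : ℕ} (hN : NP f) (hf : Iso w f) :
    ∃ (c : K) (g : S3 K), NP g ∧ Iso (w - 12) g ∧ (w < 12 → g = 0) ∧
      f = C c * X 1 ^ ((w - 6 * (w / 2 % 2)) / 4) * X 2 ^ (w / 2 % 2) + (X 1 ^ 3 - X 2 ^ 2) * g := by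
  have h : ∀ m ∈ f.support, ∃ g : S3 K, NP g ∧ Iso (w - 12) g ∧ (w < 12 → g = 0) ∧
      monomial m (coeff m f) =
        C (coeff m f) * X 1 ^ ((w - 6 * (w / 2 % 2)) / 4) * X 2 ^ (w / 2 % 2) + (X 1 ^ 3 - X 2 ^ 2) * g := by
    intro m hm
    rw [mem_support_iff] at hm
    have h0 : m 0 = 0 := by
      by_contra h; exact hm (hN m h)
    have hwt := hf hm
    rw [wt_eq, h0] at hwt
    obtain ⟨g, hg1, hg2, hg3, hg4⟩ := red_mono (coeff m f) w (m 1) (m 2) (by omega)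
    refine ⟨g, hg1, hg2, hg3, ?_⟩
    rw [← hg4, monomial_eq, Finsupp.prod_fintype _ _ (by simp), Fin.prod_univ_three, h0]
    simp [mul_assoc]
  choose! g h1 h2 h3 h4 using h
  refine ⟨∑ m ∈ f.support, coeff m f, ∑ m ∈ f.support, g m, NP.sum _ _ h1,
    IsWeightedHomogeneous.sum _ _ _ h2, fun hw => Finset.sum_eq_zero fun m hm => h3 m hm hw, ?_⟩
  conv_lhs => rw [f.as_sum, Finset.sum_congr rfl h4]
  rw [Finset.sum_add_distrib, map_sum, Finset.sum_mul, Finset.sum_mul, Finset.mul_sum]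

lemma ph_inj [IsDomain K] (h1728 : (1728 : K) ≠ 0) (w : ℕ) (f : S3 K) (hN : NP f) (hf : Iso w f)
    (h0 : ph K f = 0) : f = 0 := by
  induction w using Nat.strong_induction_on generalizing f with
  | _ w ih =>
    obtain ⟨c, g, g1, g2, g3, rfl⟩ := red hN hf
    obtain ⟨p0, p1, p2⟩ := ph_X (K := K)
    have k4 : PowerSeries.constantCoeff (e4 K) = 1 := by
      rw [← PowerSeries.coeff_zero_eq_constantCoeff_apply]; simp [e4]
    have k6 : PowerSeries.constantCoeff (e6 K) = 1 := by
      rw [← PowerSeries.coeff_zero_eq_constantCoeff_apply]; simp [e6]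
    have hc : c = 0 := by
      have := congrArg PowerSeries.constantCoeff h0
      simpa [p1, p2, k4, k6, ph_C] using this
    subst hc
    simp only [map_zero, zero_mul, zero_add] at h0 ⊢
    rw [map_mul] at h0
    have hd : ph K (X 1 ^ 3 - X 2 ^ 2) ≠ 0 := by
      intro h
      apply h1728
      have := congrArg (PowerSeries.coeff 1) h
      rw [map_sub, map_pow, map_pow, p1, p2] at this
      simp [PowerSeries.coeff_mul, pow_succ, Finset.Nat.antidiagonal_succ, e4, e6] at this
      rw [← this]; norm_num
    have hg := (mul_eq_zero.mp h0).resolve_left hd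
    by_cases hw : w < 12
    · rw [g3 hw, mul_zero]
    · rw [ih (w - 12) (by omega) g g1 g2 hg, mul_zero]

end phi
end Ram

namespace Ram

section charp
variable {p : ℕ} [hp : Fact p.Prime]

lemma iter_p_leib {K S : Type*} [CommRing K] [CommRing S] [Algebra K S] [CharP S p]
    (D : Derivation K S S) (a b : S) : D^[p] (a * b) = a * D^[p] b + b * D^[p] a := by
  rw [iter_leib, Finset.Nat.sum_antidiagonal_eq_sum_range_succ_mk, Finset.sum_range_succ,
    Finset.sum_eq_single_of_mem 0 (by simp [hp.out.pos])]
  · simp [mul_comm]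
  · intro i hi h0
    have : (p.choose i : S) = 0 := by
      rw [CharP.cast_eq_zero_iff S p]
      exact hp.out.dvd_choose_self h0 (by simpa using hi)
    simp [this]

def dp (c : ZMod p) : Derivation (ZMod p) (S3 (ZMod p)) (S3 (ZMod p)) :=
  Derivation.mk' ((DK c).toLinearMap ^ p) (fun a b => by
    simp only [Module.End.pow_apply, smul_eq_mul]
    exact iter_p_leib (DK c) a b)

lemma dp_apply (c : ZMod p) (f : S3 (ZMod p)) : dp c f = (DK c)^[p] f := by
  simp only [dp, Derivation.coe_mk', Module.End.pow_apply]
  rfl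

lemma dp_A {A : S3 (ZMod p)} {c : ZMod p} (hc : 12 * c = 1) (h1728 : (1728 : ZMod p) ≠ 0)
    (hAi : Iso (p - 1) A) (hAp : ph _ A = 1) (hAd : NP (dp c A)) : dp c A = 0 := by
  rw [dp_apply] at *
  refine ph_inj h1728 _ _ hAd (hAi.DKn c p) ?_
  rw [ph_DK_iter c hc, hAp]
  ext m
  rw [th_iter_coeff]
  by_cases h : m = 0
  · simp [h, hp.out.ne_zero]
  · simp [PowerSeries.coeff_one, h]

lemma dp_X {A : S3 (ZMod p)} {c : ZMod p} (hc : 12 * c = 1) (h1728 : (1728 : ZMod p) ≠ 0)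
    (hAN : NP A)
    (hAi : Iso (p - 1) A) (hAp : ph _ A = 1) (h1 : NP (dp c (X 1))) (h2 : NP (dp c (X 2))) :
    ∃ g1 g2, NP g1 ∧ NP g2 ∧ dp c (X 1) = A * g1 ∧ dp c (X 2) = A * g2 := by
  obtain ⟨p0, p1, p2⟩ := ph_X (K := ZMod p)
  have hp1 := hp.out.pos
  have hth : ∀ a : PowerSeries (ZMod p), th^[p] a = th a := by
    intro a
    ext m
    rw [th_iter_coeff]; simp [th]
  set B : S3 (ZMod p) := - (4 * (X 2 * pderiv 1 A) + 6 * (X 1 ^ 2 * pderiv 2 A)) with hB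
  have c4 : (C 4 : S3 (ZMod p)) = 4 := map_ofNat _ 4
  have c6 : (C 6 : S3 (ZMod p)) = 6 := map_ofNat _ 6
  have hcc : (12 : S3 (ZMod p)) * C c = 1 := by
    rw [show (12 : S3 (ZMod p)) = C 12 from (map_ofNat _ 12).symm, ← map_mul, hc, map_one]
  have hBe : B = 12 * DK c A + X 0 * A := by
    have hE := hAi.euler
    rw [DK_eq, hAN.pd] at *
    have hpm : ((p - 1 : ℕ) : S3 (ZMod p)) = -1 := by
      rw [Nat.cast_sub hp1]; simp
    rw [hpm] at hE
    simp only [map_mul, c4, c6, hB]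
    linear_combination (-(4 * (X 0 * X 1 - X 2) * pderiv 1 A) - 6 * (X 0 * X 2 - X 1 ^ 2) * pderiv 2 A) * hcc - X 0 * hE
  have hBN : NP B := by
    have : B = 0 - (C 4 * (X 2 * pderiv 1 A) + C 6 * (X 1 ^ 2 * pderiv 2 A)) := by
      rw [hB, c4, c6]; ring
    rw [this]
    exact np_zero.sub (((np_C _).mul (np_X2.mul (hAN.pdi 1))).add
      ((np_C _).mul ((np_X1.pow 2).mul (hAN.pdi 2))))
  have hBi : Iso (p + 1) B := by
    rw [hBe]
    refine IsWeightedHomogeneous.add ?_ ?_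
    · have := (hAi.DK c).C_mul 12
      rw [show (12 : S3 (ZMod p)) = C 12 from (map_ofNat _ 12).symm]
      convert! this using 1
      omega
    · convert! iX0.mul hAi using 1
      omega
  have hth1 : th (1 : PowerSeries (ZMod p)) = 0 := by simpa using th_C (1 : ZMod p)
  have hBp : ph _ B = e2 _ := by
    rw [hBe, map_add, map_mul, map_mul, ph_DK c hc, hAp, hth1, p0]; simp
  refine ⟨C (4 * c) * (B * X 1 - A * X 2), C (6 * c) * (B * X 2 - A * X 1 ^ 2),
    (np_C _).mul ((hBN.mul np_X1).sub (hAN.mul np_X2)),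
    (np_C _).mul ((hBN.mul np_X2).sub (hAN.mul (np_X1.pow 2))), ?_, ?_⟩
  · rw [← sub_eq_zero]
    refine ph_inj h1728 (4 + 2 * p) _ (h1.sub (hAN.mul ((np_C _).mul ((hBN.mul np_X1).sub (hAN.mul np_X2))))) ?_ ?_
    · refine IsWeightedHomogeneous.sub ?_ ?_
      · rw [dp_apply]; exact iX1.DKn c p
      · have h := hAi.mul ((((hBi.mul iX1).sub (n := p + 1 + 4) (by
          convert! hAi.mul iX2 using 1
          omega)).C_mul (4 * c)))
        convert! h using 1
        omega
    · rw [map_sub, dp_apply, ph_DK_iter c hc, hth, ← ph_DK c hc, DK_X1]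
      simp [hAp, hBp, p0, p1, p2]
  · rw [← sub_eq_zero]
    refine ph_inj h1728 (6 + 2 * p) _ (h2.sub (hAN.mul ((np_C _).mul ((hBN.mul np_X2).sub (hAN.mul (np_X1.pow 2)))))) ?_ ?_
    · refine IsWeightedHomogeneous.sub ?_ ?_
      · rw [dp_apply]; exact iX2.DKn c p
      · have h := hAi.mul ((((hBi.mul iX2).sub (n := p + 1 + 6) (by
          convert! hAi.mul (iX1.pow 2) using 1
          simp; omega)).C_mul (6 * c)))
        convert! h using 1
        omega
    · rw [map_sub, dp_apply, ph_DK_iter c hc, hth, ← ph_DK c hc, DK_X2]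
      simp [hAp, hBp, p0, p1, p2]

lemma dp_pow {A : S3 (ZMod p)} {c : ZMod p} (hAN : NP A) (hA0 : dp c A = 0)
    (hX : ∃ g1 g2, NP g1 ∧ NP g2 ∧ dp c (X 1) = A * g1 ∧ dp c (X 2) = A * g2)
    (f : S3 (ZMod p)) (hf : NP f) (n : ℕ) : ∃ g, NP g ∧ (dp c)^[n] f = A ^ n * g := by
  obtain ⟨g1, g2, n1, n2, h1, h2⟩ := hX
  induction n with
  | zero => exact ⟨f, hf, by simp⟩
  | succ n ih =>
    obtain ⟨g, hg, he⟩ := ih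
    refine ⟨g1 * pderiv 1 g + g2 * pderiv 2 g, (n1.mul (hg.pdi 1)).add (n2.mul (hg.pdi 2)), ?_⟩
    rw [Function.iterate_succ_apply', he, Derivation.leibniz, Derivation.leibniz_pow, hA0,
      der_eq, hg.pd, h1, h2]
    simp; ring

lemma main_charp {A : S3 (ZMod p)} {c : ZMod p} (hAN : NP A) (hA0 : dp c A = 0)
    (hX : ∃ g1 g2, NP g1 ∧ NP g2 ∧ dp c (X 1) = A * g1 ∧ dp c (X 2) = A * g2)
    (f : S3 (ZMod p)) (hf : NP f) : ∃ g, (DK c)^[p ^ 2] f = A ^ p * g := by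
  obtain ⟨g, _, h⟩ := dp_pow hAN hA0 hX f hf p
  refine ⟨g, ?_⟩
  rw [← h, pow_two, Function.iterate_mul]
  congr 1
  ext f; rw [dp_apply]

lemma main_charp2 {A : S3 (ZMod p)} {c : ZMod p} (hA0 : dp c A = 0) :
    (DK c)^[p ^ 2 - 1] (A ^ (p - 1) * DK c A) = 0 := by
  have h2 := hp.out.two_le
  have : p ^ 2 - 1 = (p ^ 2 - 1 - p) + p := by
    have : p + 1 ≤ p ^ 2 := by nlinarith
    omega
  rw [this, Function.iterate_add_apply, ← dp_apply, Derivation.leibniz, Derivation.leibniz_pow, hA0,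
    dp_apply, ← Function.iterate_succ_apply, Function.iterate_succ_apply', ← dp_apply, hA0]
  simp only [map_zero, smul_zero, add_zero]
  exact Function.iterate_fixed (map_zero _) _

end charp
end Ram

namespace Ram

variable {p : ℕ} [hp : Fact p.Prime]

section gen
variable {S : Type*} [CommRing S] {K : Type*} [CommRing K] [Algebra K S]

lemma der_ideal (D : Derivation K S S) (p : ℕ) (A : S) (n : ℕ) (x : S)
    (hx : x ∈ Ideal.span {A ^ p, (p : S)} ^ n) : D x ∈ Ideal.span {A ^ p, (p : S)} ^ n := by
  set I := Ideal.span {A ^ p, (p : S)} with hI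
  have hA : A ^ p ∈ I := Ideal.subset_span (by simp)
  have hpI : (p : S) ∈ I := Ideal.subset_span (by simp)
  induction n generalizing x with
  | zero => simp
  | succ n ih =>
    rw [pow_succ] at hx
    induction hx using Submodule.mul_induction_on' with
    | mem_mul_mem a ha b hb =>
      have hDb : D b ∈ I := by
        obtain ⟨u, v, rfl⟩ := Ideal.mem_span_pair.1 hb
        have : D (u * A ^ p + v * (p:S)) = A ^ p * D u + (p : S) * (u * (A ^ (p-1) * D A) + D v) := by
          rw [map_add, D.leibniz, D.leibniz, D.leibniz_pow, D.map_natCast]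
          simp only [smul_eq_mul, nsmul_eq_mul, mul_zero]; ring
        rw [this]
        exact I.add_mem (I.mul_mem_right _ hA) (I.mul_mem_right _ hpI)
      rw [D.leibniz, pow_succ, smul_eq_mul, smul_eq_mul, mul_comm b]
      exact Ideal.add_mem _ (Ideal.mul_mem_mul ha hDb) (Ideal.mul_mem_mul (ih _ ha) hb)
    | add x _ y _ h1 h2 => rw [map_add]; exact Ideal.add_mem _ h1 h2

lemma der_iter_ideal (D : Derivation K S S) (p : ℕ) (A : S) (n j : ℕ) (x : S)
    (hx : x ∈ Ideal.span {A ^ p, (p : S)} ^ n) : D^[j] x ∈ Ideal.span {A ^ p, (p : S)} ^ n := by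
  induction j with
  | zero => simpa
  | succ j ih => rw [Function.iterate_succ_apply']; exact der_ideal D p A n _ ih

lemma leib_mod (D : Derivation K S S) (A : S) (a b : ℕ) (x y : S)
    (hx : x ∈ Ideal.span {A ^ p, (p : S)} ^ a) (hy : y ∈ Ideal.span {A ^ p, (p : S)} ^ b)
    (hx' : D^[p ^ 2] x ∈ Ideal.span {A ^ p, (p : S)} ^ (a + 1))
    (hy' : D^[p ^ 2] y ∈ Ideal.span {A ^ p, (p : S)} ^ (b + 1)) :
    D^[p ^ 2] (x * y) ∈ Ideal.span {A ^ p, (p : S)} ^ (a + b + 1) := by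
  set I := Ideal.span {A ^ p, (p : S)} with hI
  have hpI : (p : S) ∈ I := Ideal.subset_span (by simp)
  rw [iter_leib]
  refine Ideal.sum_mem _ fun ij hij => ?_
  rw [Finset.HasAntidiagonal.mem_antidiagonal] at hij
  rw [nsmul_eq_mul]
  by_cases h1 : ij.1 = 0
  · have h2 : ij.2 = p ^ 2 := by omega
    rw [h1, h2]
    refine Ideal.mul_mem_left _ _ ?_
    rw [add_assoc, pow_add]
    exact Ideal.mul_mem_mul hx hy'
  by_cases h2 : ij.2 = 0
  · have h1 : ij.1 = p ^ 2 := by omega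
    rw [h1, h2]
    refine Ideal.mul_mem_left _ _ ?_
    rw [add_right_comm, pow_add]
    exact Ideal.mul_mem_mul hx' hy
  · have : p ∣ (p ^ 2).choose ij.1 := hp.out.dvd_choose_pow h1 (by omega)
    obtain ⟨t, ht⟩ := this
    rw [ht, Nat.cast_mul, mul_comm (p : S), mul_assoc]
    refine Ideal.mul_mem_left _ _ ?_
    rw [pow_succ', pow_add]
    exact Ideal.mul_mem_mul hpI (Ideal.mul_mem_mul (der_iter_ideal D p A a _ x hx) (der_iter_ideal D p A b _ y hy))

lemma der_nat_mul (D : Derivation K S S) (q j : ℕ) (x : S) :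
    D^[j] ((q : S) * x) = (q : S) * D^[j] x := by
  induction j with
  | zero => rfl
  | succ j ih => rw [Function.iterate_succ_apply', ih, Function.iterate_succ_apply', D.leibniz]; simp

lemma expand_pow (x y : S) (n : ℕ) (z : S) (hz : z ∈ Ideal.span {x, y} ^ n) :
    ∃ G : ℕ → S, z = ∑ i ∈ Finset.range (n + 1), y ^ (n - i) * x ^ i * G i := by
  induction n generalizing z with
  | zero => exact ⟨fun _ => z, by simp⟩
  | succ n ih =>
    rw [pow_succ] at hz
    induction hz using Submodule.mul_induction_on' with
    | mem_mul_mem a ha b hb =>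
      obtain ⟨G, rfl⟩ := ih a ha
      obtain ⟨u, v, rfl⟩ := Ideal.mem_span_pair.1 hb
      refine ⟨fun i => (if i ≤ n then G i * v else 0) + (if i = 0 then 0 else G (i - 1) * u), ?_⟩
      simp only [mul_add, Finset.sum_add_distrib]
      rw [add_comm, Finset.sum_range_succ _ (n+1), if_neg (by omega), Finset.sum_range_succ' _ (n+1)]
      simp only [mul_zero, add_zero, if_true, Nat.add_sub_cancel, if_neg (Nat.succ_ne_zero _), Finset.sum_mul]
      congr 1
      · refine Finset.sum_congr rfl fun i hi => ?_
        rw [Finset.mem_range] at hi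
        rw [if_pos (by omega), show n + 1 - i = (n - i) + 1 by omega, pow_succ]; ring
      · refine Finset.sum_congr rfl fun i hi => ?_
        rw [Finset.mem_range] at hi
        rw [show n + 1 - (i + 1) = (n - i) by omega, pow_succ]; ring
    | add x _ y _ h1 h2 =>
      obtain ⟨G, hG⟩ := h1
      obtain ⟨H, hH⟩ := h2
      refine ⟨fun i => G i + H i, ?_⟩
      rw [hG, hH]; simp only [mul_add, Finset.sum_add_distrib]
end gen

/-- The general `n` step over an abstract base. -/
lemma step_n {K : Type*} [CommRing K] (φ : K →+* ZMod p) (hφ : Function.Surjective φ)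
    (hker : ∀ x, φ x = 0 → (p : K) ∣ x) (c : K) (A : S3 K) (hAN : NP A)
    (hA0 : dp (φ c) (map φ A) = 0)
    (hX : ∃ g1 g2, NP g1 ∧ NP g2 ∧ dp (φ c) (X 1) = map φ A * g1 ∧ dp (φ c) (X 2) = map φ A * g2)
    (n : ℕ) (F : S3 K) (hF : NP F) (G : ℕ → S3 K)
    (hG : F = ∑ i ∈ Finset.range (n + 1), (p : S3 K) ^ (n - i) * A ^ (p * i) * G i) :
    (DK c)^[p ^ 2] F ∈ Ideal.span {A ^ p, (p : S3 K)} ^ (n + 1) := by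
  set I := Ideal.span {A ^ p, (p : S3 K)} with hI
  have hAI : A ^ p ∈ I := Ideal.subset_span (by simp)
  have hpI : (p : S3 K) ∈ I := Ideal.subset_span (by simp)
  have hk : ∀ f : S3 K, map φ f = 0 → ∃ g, f = (p : S3 K) * g := by
    intro f hf
    have : C (p : K) ∣ f := by
      rw [MvPolynomial.C_dvd_iff_dvd_coeff]
      intro m
      exact hker _ (by rw [← coeff_map, hf, coeff_zero])
    obtain ⟨g, hg⟩ := this
    exact ⟨g, by rw [hg]; simp⟩
  have hmapNP : ∀ f : S3 K, NP f → NP (map φ f) := by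
    intro f hf m hm
    rw [coeff_map, hf m hm, map_zero]
  have hT : ∀ f : S3 K, NP f → (DK c)^[p ^ 2] f ∈ I := by
    intro f hf
    obtain ⟨g, hg⟩ := main_charp (hmapNP _ hAN) hA0 hX (map φ f) (hmapNP _ hf)
    obtain ⟨g', rfl⟩ := MvPolynomial.map_surjective φ hφ g
    rw [← map_DK_iter, ← map_pow, ← map_mul, ← sub_eq_zero, ← map_sub] at hg
    obtain ⟨h, hh⟩ := hk _ hg
    rw [sub_eq_iff_eq_add] at hh
    rw [hh]
    exact I.add_mem (I.mul_mem_right _ hpI) (I.mul_mem_right _ hAI)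
  have hTA : (DK c)^[p ^ 2] (A ^ p) ∈ I ^ 2 := by
    have h0 := main_charp2 hA0
    rw [← map_DK, ← map_pow, ← map_mul, ← map_DK_iter] at h0
    obtain ⟨g, hg⟩ := hk _ h0
    have h2 : p ^ 2 = (p ^ 2 - 1) + 1 := by
      have := Nat.pow_pos (n := 2) hp.out.pos
      omega
    rw [h2, Function.iterate_succ_apply, Derivation.leibniz_pow, smul_eq_mul, nsmul_eq_mul, der_nat_mul, hg,
      ← mul_assoc, pow_two]
    exact Ideal.mul_mem_right _ _ (Ideal.mul_mem_mul hpI hpI)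
  have hTi : ∀ i, (DK c)^[p ^ 2] ((A ^ p) ^ i) ∈ I ^ (i + 1) := by
    intro i
    induction i with
    | zero =>
      rw [pow_zero, zero_add, pow_one]
      exact hT _ (by simpa using np_C (1 : K))
    | succ i ih =>
      rw [pow_succ]
      exact leib_mod (DK c) A i 1 _ _ (Ideal.pow_mem_pow hAI i) (by simpa using hAI) ih hTA
  let π : S3 K →ₐ[K] S3 K := aeval ![0, X 1, X 2]
  have hπN : ∀ f, NP (π f) := by
    intro f
    induction f using MvPolynomial.induction_on with
    | C a => simpa [π] using np_C a
    | add f g h1 h2 => rw [map_add]; exact h1.add h2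
    | mul_X f i h =>
      rw [map_mul]
      refine h.mul ?_
      fin_cases i
      · simpa [π] using np_zero
      · simpa [π] using np_X1
      · simpa [π] using np_X2
  have hπ : ∀ f, NP f → π f = f := by
    intro f hf
    conv_rhs => rw [f.as_sum]
    conv_lhs => rw [f.as_sum]
    rw [map_sum]
    refine Finset.sum_congr rfl fun m hm => ?_
    have hm0 : m 0 = 0 := by
      by_contra h
      exact (mem_support_iff.1 hm) (hf m h)
    rw [monomial_eq, map_mul]
    simp [π, Finsupp.prod_fintype, Fin.prod_univ_three, hm0]
  have hG' := congrArg π hG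
  rw [hπ F hF, map_sum] at hG'
  rw [hG', ← Derivation.coeFn_coe, ← Module.End.pow_apply, map_sum]
  refine Ideal.sum_mem _ fun i hi => ?_
  rw [Finset.mem_range] at hi
  rw [Module.End.pow_apply, Derivation.coeFn_coe, map_mul, map_mul, map_pow, map_pow, hπ A hAN, map_natCast,
    ← Nat.cast_pow, mul_assoc, der_nat_mul, Nat.cast_pow, show n + 1 = (n - i) + (i + 1) by omega, pow_add,
    pow_mul]
  refine Ideal.mul_mem_mul (Ideal.pow_mem_pow hpI _) ?_
  exact leib_mod (DK c) A i 0 _ _ (Ideal.pow_mem_pow hAI i) (by simp) (hTi i) (by simpa using hT _ (hπN _))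

end Ram

namespace Ram

variable (p : ℕ) [hp : Fact p.Prime]

/-- The ring of `p`-integral rationals. -/
def Zp : Subring ℚ := (Rat.padicValuation p).integer

variable {p}
lemma mem_Zp {x : ℚ} : x ∈ Zp p ↔ pInt p x := by
  unfold pInt
  rw [← Rat.padicValuation_le_one_iff]; rfl

lemma den_ne {x : ℚ} (hx : x ∈ Zp p) : (x.den : ZMod p) ≠ 0 := by
  rw [Ne, ZMod.natCast_eq_zero_iff]
  exact mem_Zp.1 hx

variable (p) in
/-- Reduction modulo `p`. -/
def rd : Zp p →+* ZMod p where
  toFun x := ((x : ℚ) : ZMod p)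
  map_one' := by simp
  map_zero' := by simp
  map_add' x y := Rat.cast_add_of_ne_zero (den_ne x.2) (den_ne y.2)
  map_mul' x y := Rat.cast_mul_of_ne_zero (den_ne x.2) (den_ne y.2)

lemma rd_surj : Function.Surjective (rd p) := fun x => ⟨(x.val : Zp p), by simp⟩

lemma inv_mem {a : ℕ} (ha : ¬ p ∣ a) : (1 / a : ℚ) ∈ Zp p := by
  rw [mem_Zp, pInt, one_div]
  intro h
  have : a ≠ 0 := by rintro rfl; simp at ha
  rw [Rat.inv_natCast_den_of_pos (by omega)] at h
  exact ha h

lemma rd_ker (x : Zp p) (hx : rd p x = 0) : (p : Zp p) ∣ x := by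
  have h : (((x : ℚ).num : ℤ) : ZMod p) = 0 := by
    have h1 : ((x : ℚ) : ZMod p) = 0 := hx
    rw [Rat.cast_def, div_eq_zero_iff] at h1
    exact h1.resolve_right (den_ne x.2)
  rw [ZMod.intCast_zmod_eq_zero_iff_dvd] at h
  obtain ⟨t, ht⟩ := h
  refine ⟨(t : Zp p) * ⟨_, inv_mem (mem_Zp.1 x.2)⟩, ?_⟩
  ext
  push_cast
  have := Rat.num_div_den (x : ℚ)
  rw [ht] at this
  conv_lhs => rw [← this]
  push_cast
  ring

lemma rd_p : rd p (p : Zp p) = 0 := by simp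

lemma bern (hp5 : 5 ≤ p) : ∃ y ∈ Zp p, (p : ℚ) * bernoulli (p - 1) = -1 + p * y := by
  have hodd := hp.out.odd_of_ne_two (by omega)
  obtain ⟨k, hk⟩ := hodd
  have hk' : p - 1 = 2 * k := by omega
  obtain ⟨N, hN⟩ := Bernoulli.vonStaudt_clausen k
  rw [← hk', show p - 1 + 2 = p + 1 by omega, Finset.sum_filter, Finset.sum_range_succ, if_pos ⟨hp.out, dvd_rfl⟩] at hN
  refine ⟨N - ∑ q ∈ Finset.range p, if q.Prime ∧ (q - 1) ∣ (p - 1) then (1 : ℚ) / q else 0, ?_, ?_⟩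
  · refine (Zp p).sub_mem (intCast_mem _ N) ((Zp p).sum_mem fun q hq => ?_)
    rw [Finset.mem_range] at hq
    split_ifs with h
    · exact inv_mem (Nat.not_dvd_of_pos_of_lt h.1.pos hq)
    · exact (Zp p).zero_mem
  · have hp0 : (p : ℚ) ≠ 0 := by exact_mod_cast hp.out.ne_zero
    rw [hN]
    field_simp
    ring

lemma lift_poly {f : Poly3} (hf : polyPInt p f) : ∃ g : S3 (Zp p), map (Zp p).subtype g = f := by
  have : f ∈ Set.range (map (σ := Fin 3) (Zp p).subtype) := by
    rw [MvPolynomial.mem_range_map_iff_coeffs_subset]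
    intro c hc
    rw [Finset.mem_coe, MvPolynomial.mem_coeffs_iff] at hc
    obtain ⟨m, _, rfl⟩ := hc
    exact ⟨⟨_, mem_Zp.2 (hf m)⟩, rfl⟩
  exact this

lemma mapZ_inj : Function.Injective (map (σ := Fin 3) (Zp p).subtype) :=
  map_injective _ Subtype.val_injective

lemma np_lift {g : S3 (Zp p)} (h : NoP (map (Zp p).subtype g)) : NP g := by
  intro m hm
  by_contra h0
  refine hm (h m ?_)
  rw [mem_support_iff, coeff_map]
  intro h1
  exact h0 (Subtype.val_injective h1)

lemma iso_lift {k : ℕ} {g : S3 (Zp p)} (h : Isobaric k (map (Zp p).subtype g)) : Iso k g := by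
  intro m hm
  rw [wt_eq]
  refine h m ?_
  rw [mem_support_iff, coeff_map]
  intro h1
  exact hm (Subtype.val_injective h1)

lemma ph_A (hp5 : 5 ≤ p) (A : S3 (Zp p)) (h : Phi (map (Zp p).subtype A) = EAs p) :
    ph (ZMod p) (map (rd p) A) = 1 := by
  rw [Phi_eq, ← map_ph] at h
  rw [← map_ph]
  ext n
  have hn := congrArg (PowerSeries.coeff n) h
  rw [PowerSeries.coeff_map, EAs, PowerSeries.coeff_mk] at hn
  rw [PowerSeries.coeff_map, PowerSeries.coeff_one]
  set x := PowerSeries.coeff n (ph (Zp p) A)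
  by_cases h0 : n = 0
  · rw [if_pos h0] at hn ⊢
    have : x = 1 := Subtype.val_injective hn
    rw [this, map_one]
  · rw [if_neg h0] at hn ⊢
    have hxq : (x : ℚ) = -(2 * ((p : ℚ) - 1) / bernoulli (p - 1)) * sigmaQ (p - 2) n := hn
    obtain ⟨y, hy, hB⟩ := bern hp5
    by_cases hB0 : bernoulli (p - 1) = 0
    · rw [hB0] at hxq
      have : x = 0 := Subtype.val_injective (by simpa using hxq)
      rw [this, map_zero]
    · have hs : sigmaQ (p - 2) n ∈ Zp p := by
        unfold sigmaQ
        exact (Zp p).sum_mem fun d _ => (Zp p).pow_mem (natCast_mem _ d) _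
      have key : x = (p : Zp p) * (x * ⟨y, hy⟩ + 2 * ((p : Zp p) - 1) * ⟨_, hs⟩) := by
        apply Subtype.val_injective
        push_cast
        have h1 : (x : ℚ) * (p * bernoulli (p - 1)) = -(2 * ((p : ℚ) - 1)) * sigmaQ (p - 2) n * p := by
          rw [hxq]; field_simp
        rw [hB] at h1
        have h2 : ((2 : Zp p) : ℚ) = 2 := rfl
        simp only [h2]
        linear_combination -h1
      rw [key, map_mul, rd_p, zero_mul]

theorem main_thm (p : ℕ) (hp : p.Prime) (hp5 : 5 ≤ p)
    (A : Poly3) (hAiso : Isobaric (p - 1) A) (hAnoP : NoP A)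
    (hAint : polyPInt p A) (hAPhi : Phi A = EAs p)
    (k : ℕ) (hk : 0 < k) (F : Poly3) (hFiso : Isobaric k F) (hFnoP : NoP F)
    (hFint : polyPInt p F)
    (n : ℕ) (hF : InIdealPow p A n F) :
    InIdealPow p A (n + 1) (Dop^[p ^ 2] F) := by
  have : Fact p.Prime := ⟨hp⟩
  obtain ⟨A, rfl⟩ := lift_poly hAint
  obtain ⟨F, rfl⟩ := lift_poly hFint
  obtain ⟨G, hG, hFG⟩ := hF
  choose G' hG' using fun i => lift_poly (hG i)
  have hFG' : F = ∑ i ∈ Finset.range (n + 1), (p : S3 (Zp p)) ^ (n - i) * A ^ (p * i) * G' i := by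
    apply mapZ_inj
    rw [hFG, map_sum]
    refine Finset.sum_congr rfl fun i _ => ?_
    rw [map_mul, map_mul, map_pow, map_pow, hG', map_natCast]
  have h12 : ¬ p ∣ 12 := by
    intro h
    have h' : p ∣ 2 ^ 2 * 3 := by simpa using h
    rcases hp.dvd_mul.1 h' with h | h
    · exact absurd (Nat.le_of_dvd (by norm_num) (hp.dvd_of_dvd_pow h)) (by omega)
    · exact absurd (Nat.le_of_dvd (by norm_num) h) (by omega)
  let c : Zp p := ⟨1 / (12 : ℕ), inv_mem h12⟩
  have hcv : (Zp p).subtype c = 1 / 12 := by simp [c]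
  have hc1 : 12 * c = 1 := by
    apply Subtype.val_injective
    change (12 : ℚ) * (Zp p).subtype c = 1
    rw [hcv]; norm_num
  have hc : 12 * rd p c = 1 := by
    have := congrArg (rd p) hc1
    rwa [map_mul, map_one, map_ofNat] at this
  have h1728 : (1728 : ZMod p) ≠ 0 := by
    have h : (12 : ZMod p) ≠ 0 := by
      intro h; rw [h, zero_mul] at hc; exact zero_ne_one hc
    have : (1728 : ZMod p) = 12 ^ 3 := by norm_num
    rw [this]; exact pow_ne_zero _ h
  have hAN := np_lift hAnoP
  have hAi := iso_lift hAiso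
  have hnp : ∀ (j : ℕ) (f : S3 (Zp p)), 0 < j → Iso j f → NP f → NP (dp (rd p c) (map (rd p) f)) := by
    intro j f hj hf hN m hm
    obtain ⟨t, ht⟩ := dvd_coeff c hj hf hN p hp m hm
    rw [dp_apply, ← map_DK_iter, coeff_map, ht, map_mul, rd_p, zero_mul]
  have hANr : NP (map (rd p) A) := fun m hm => by rw [coeff_map, hAN m hm, map_zero]
  have hAir : Iso (p - 1) (map (rd p) A) := by
    intro m hm
    refine hAi ?_
    intro h0
    rw [coeff_map, h0, map_zero] at hm
    exact hm rfl
  have hAp := ph_A hp5 A hAPhi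
  have hA0 := dp_A hc h1728 hAir hAp (hnp (p - 1) A (by omega) hAi hAN)
  have hX := dp_X hc h1728 hANr hAir hAp
    (by simpa using hnp 4 (X 1) (by norm_num) iX1 np_X1)
    (by simpa using hnp 6 (X 2) (by norm_num) iX2 np_X2)
  have hmain := step_n (rd p) rd_surj rd_ker c A hAN hA0 hX n F (np_lift hFnoP) G' hFG'
  obtain ⟨H, hH⟩ := expand_pow _ _ _ _ hmain
  refine ⟨fun i => map (Zp p).subtype (H i), fun i m => ?_, ?_⟩
  · rw [coeff_map]; exact mem_Zp.1 (coeff m (H i)).2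
  · have hD : Dop = ⇑(DK (1 / 12 : ℚ)) := funext Dop_eq
    rw [hD, ← hcv, ← map_DK_iter, hH, map_sum]
    refine Finset.sum_congr rfl fun i _ => ?_
    rw [map_mul, map_mul, map_pow, map_pow, map_pow, map_natCast, pow_mul]

end Ram

theorem stmt_15 (p : ℕ) (hp : p.Prime) (hp5 : 5 ≤ p)
    (A : Poly3) (hAiso : Isobaric (p - 1) A) (hAnoP : NoP A)
    (hAint : polyPInt p A) (hAPhi : Phi A = EAs p)
    (k : ℕ) (hk : 0 < k) (F : Poly3) (hFiso : Isobaric k F) (hFnoP : NoP F)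
    (hFint : polyPInt p F)
    (n : ℕ) (hF : InIdealPow p A n F) :
    InIdealPow p A (n + 1) (Dop^[p ^ 2] F) := by
  exact Ram.main_thm p hp hp5 A hAiso hAnoP hAint hAPhi k hk F hFiso hFnoP hFint n hF
end
end
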